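/- Let α = (α₁, α₂, α₃) ∈ ℝ³ with α₁ = 1 and with α₂, α₃ irrational real numbers that are algebraic over ℚ. Let r ≥ 2 be an integer and let Ψ : ℤ³ × ℝ → ℝ be a cocycle over the translation action T(n, x) = x + n·α such that for each n ∈ ℤ³ the map x ↦ Ψ(n, x) is r-times continuously differentiable. Then there exist a continuous function w : ℝ → ℝ and an additive group homomorphism c : ℤ³ → ℝ such that Ψ(n, x) = w(x + n·α) − w(x) + c(n) for all n ∈ ℤ³ and all x ∈ ℝ. Moreover, w is (r−2)-times continuously differentiable. -/

import Mathlib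

/-- Wronskian criterion: over a field `K`, linearly independent elements of a differential domain
have a nonvanishing generalized Wronskian built from operators of controlled order. -/
theorem exists_wronskian_ne_zero {K R ι H : Type*} [Field K] [CommRing R] [IsDomain R] [Algebra K R]
    (D : ι → R →ₗ[K] R) (ord : ι → ℕ) (o : ι) (ho : ord o = 0) (hD : ∀ f, D o f = f)
    (δ : H → Derivation K R R)
    (hδ : ∀ h b, ∃ b' : ι, ∃ c : R, ord b' = ord b + 1 ∧ ∀ f, δ h (D b f) = c * D b' f)
    (hconst : ∀ A B : R, A ≠ 0 → (∀ h, A * δ h B = B * δ h A) → ∃ c : K, B = c • A)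
    (k : ℕ) (f : Fin k → R) (hf : LinearIndependent K f) :
    ∃ b : Fin k → ι, (∀ i, ord (b i) ≤ i) ∧
      (Matrix.of fun i j => D (b i) (f j)).det ≠ 0 := by
  induction k with
  | zero => exact ⟨Fin.elim0, fun i => i.elim0, by simp⟩
  | succ k ih =>
    obtain ⟨b, hb, hdet⟩ := ih (f ∘ Fin.castSucc) (hf.comp _ (Fin.castSucc_injective k))
    by_contra! hcon
    set A : Fin (k + 1) → R := fun j => (-1) ^ (k + (j : ℕ)) *
      (Matrix.of fun i l : Fin k => D (b i) (f (j.succAbove l))).det with hA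
    have hAlast : A (Fin.last k) ≠ 0 := by
      simp only [hA, Fin.succAbove_last]
      exact mul_ne_zero (pow_ne_zero _ (by simp)) hdet
    have h1 : ∀ β, ord β ≤ k → ∑ j, A j * D β (f j) = 0 := by
      intro β hβ
      have := hcon (Fin.snoc b β) (by
        intro i
        refine Fin.lastCases ?_ (fun i => ?_) i
        · simpa using hβ
        · simpa using hb i)
      rw [Matrix.det_succ_row _ (Fin.last k)] at this
      rw [← this]
      refine Finset.sum_congr rfl fun j _ => ?_
      simp only [hA, Fin.val_last, Matrix.of_apply, Fin.snoc_last, Matrix.submatrix,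
        Fin.succAbove_last, Fin.snoc_castSucc]
      ring
    have h2 : ∀ h β, ord β + 1 ≤ k → ∑ j, δ h (A j) * D β (f j) = 0 := by
      intro h β hβ
      obtain ⟨β', c, hβ', hc⟩ := hδ h β
      have e := congrArg (δ h) (h1 β (by omega))
      simp only [map_sum, Derivation.leibniz, map_zero, smul_eq_mul, Finset.sum_add_distrib, hc]
        at e
      have e2 := h1 β' (by omega)
      have : ∑ j, A j * (c * D β' (f j)) = c * ∑ j, A j * D β' (f j) := by
        rw [Finset.mul_sum]; exact Finset.sum_congr rfl fun j _ => by ring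
      rw [this, e2, mul_zero, zero_add] at e
      rw [← e]
      exact Finset.sum_congr rfl fun j _ => by ring
    have h3 : ∀ h (j : Fin k), A (Fin.last k) * δ h (A j.castSucc) =
        A j.castSucc * δ h (A (Fin.last k)) := by
      intro h
      have := Matrix.eq_zero_of_mulVec_eq_zero (v := fun j : Fin k =>
        A (Fin.last k) * δ h (A j.castSucc) - A j.castSucc * δ h (A (Fin.last k))) hdet (by
        funext i
        have e1 := h1 (b i) (by have := hb i; omega)
        have e2 := h2 h (b i) (by have := hb i; omega)
        rw [Fin.sum_univ_castSucc] at e1 e2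
        simp only [Matrix.mulVec, dotProduct, Matrix.of_apply, Function.comp, Pi.zero_apply]
        have : ∑ x : Fin k, D (b i) (f x.castSucc) * (A (Fin.last k) * δ h (A x.castSucc) -
            A x.castSucc * δ h (A (Fin.last k))) =
            A (Fin.last k) * ∑ x : Fin k, δ h (A x.castSucc) * D (b i) (f x.castSucc) -
            δ h (A (Fin.last k)) * ∑ x : Fin k, A x.castSucc * D (b i) (f x.castSucc) := by
          rw [Finset.mul_sum, Finset.mul_sum, ← Finset.sum_sub_distrib]
          exact Finset.sum_congr rfl fun j _ => by ring
        rw [this]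
        linear_combination A (Fin.last k) * e2 - δ h (A (Fin.last k)) * e1)
      intro j
      exact sub_eq_zero.1 (congrFun this j)
    choose c hc using fun j : Fin k => hconst _ _ hAlast fun h => h3 h j
    have h4 := h1 o (by omega)
    simp only [hD, Fin.sum_univ_castSucc, hc] at h4
    have h5 : A (Fin.last k) * (∑ j : Fin k, c j • f j.castSucc + f (Fin.last k)) = 0 := by
      rw [← h4, mul_add, Finset.mul_sum]
      congr 1
      exact Finset.sum_congr rfl fun j _ => by rw [smul_mul_assoc, mul_smul_comm]
    have h6 := (mul_eq_zero.1 h5).resolve_left hAlast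
    have h7 := Fintype.linearIndependent_iff.1 hf (Fin.snoc c 1) (by
      simpa [Fin.sum_univ_castSucc] using h6) (Fin.last k)
    simp at h7

theorem Polynomial.eq_smul_of_mul_derivative_eq {K : Type*} [Field K] [CharZero K]
    {A B : Polynomial K} (hA : A.eval 0 ≠ 0) (hB : B.eval 0 = 0)
    (h : A * derivative B = B * derivative A) : B = 0 := by
  have key : ∀ n : ℕ, X ^ n ∣ B := by
    intro n
    induction n with
    | zero => simp
    | succ n ih =>
      rcases Nat.eq_zero_or_pos n with rfl | hn
      · simpa [X_dvd_iff, coeff_zero_eq_eval_zero] using hB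
      obtain ⟨g, rfl⟩ := ih
      obtain ⟨m, rfl⟩ : ∃ m, n = m + 1 := ⟨n - 1, by omega⟩
      have e : X ^ m * (A * ((m + 1 : ℕ) • g)) =
          X ^ m * (X * (g * derivative A - A * derivative g)) := by
        simp only [derivative_mul, derivative_X_pow, Nat.add_sub_cancel] at h
        simp only [map_natCast, nsmul_eq_mul] at h ⊢
        linear_combination h
      have e' := mul_left_cancel₀ (pow_ne_zero m X_ne_zero) e
      have h0 := congrArg (eval 0) e'
      simp only [eval_mul, eval_X, zero_mul, eval_smul, mul_eq_zero, hA, false_or] at h0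
      have hg : g.eval 0 = 0 := by
        rcases (smul_eq_zero.1 h0) with h0 | h0
        · omega
        · exact h0
      rw [pow_succ]
      refine mul_dvd_mul_left _ ?_
      rwa [X_dvd_iff, coeff_zero_eq_eval_zero]
  by_contra hB0
  have := natDegree_le_of_dvd (key (B.natDegree + 1)) hB0
  simp at this

theorem Polynomial.exists_eq_smul_of_mul_derivative_eq {K : Type*} [Field K] [CharZero K]
    (A B : Polynomial K) (hA : A ≠ 0)
    (h : A * derivative B = B * derivative A) : ∃ c : K, B = c • A := by
  obtain ⟨x, hx⟩ : ∃ x, A.eval x ≠ 0 := by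
    by_contra! hcon
    exact hA (Polynomial.funext fun x => by simpa using hcon x)
  refine ⟨B.eval x / A.eval x, ?_⟩
  have := Polynomial.eq_smul_of_mul_derivative_eq (A := A.comp (X + C x))
    (B := (B - (B.eval x / A.eval x) • A).comp (X + C x)) (by simpa using hx)
    (by simp [hx]) (by
      simp only [derivative_comp, derivative_sub, derivative_smul, derivative_add, derivative_X,
        derivative_C, add_zero, one_mul, ← mul_comp]
      congr 1
      rw [mul_sub, sub_mul, h, mul_smul_comm, smul_mul_assoc])
  have h2 := congrArg (fun p => p.comp (X - C x)) this
  simp only [comp_assoc, add_comp, X_comp, C_comp, sub_add_cancel, comp_X, zero_comp] at h2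
  exact sub_eq_zero.1 h2

theorem MvPolynomial.derivative_aeval_line {K : Type*} [Field K] {n : ℕ}
    (ξ η : Fin n → K) (P : MvPolynomial (Fin n) K) :
    Polynomial.derivative
      (aeval (fun h => Polynomial.C (ξ h) + Polynomial.C (η h) * Polynomial.X) P)
      = ∑ h, Polynomial.C (η h) *
        aeval (fun h => Polynomial.C (ξ h) + Polynomial.C (η h) * Polynomial.X) (pderiv h P) := by
  induction P using MvPolynomial.induction_on with
  | C a => simp
  | add p q hp hq => simp only [map_add, hp, hq, mul_add, Finset.sum_add_distrib]
  | mul_X p i hp =>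
    have hi : ∀ j, aeval (fun h => Polynomial.C (ξ h) + Polynomial.C (η h) * Polynomial.X)
        (pderiv j (p * X i)) =
        aeval (fun h => Polynomial.C (ξ h) + Polynomial.C (η h) * Polynomial.X) (pderiv j p) *
          (Polynomial.C (ξ i) + Polynomial.C (η i) * Polynomial.X) +
        if j = i then
          aeval (fun h => Polynomial.C (ξ h) + Polynomial.C (η h) * Polynomial.X) p else 0 := by
      intro j
      rw [pderiv_mul, map_add, map_mul, map_mul, aeval_X, pderiv_X]
      split_ifs with hj
      · subst hj; simp
      · rw [Pi.single_eq_of_ne (Ne.symm hj)]; simp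
    simp_rw [hi, mul_add, Finset.sum_add_distrib, mul_ite, mul_zero]
    rw [Finset.sum_ite_eq' Finset.univ i, map_mul, aeval_X, Polynomial.derivative_mul, hp,
      Finset.sum_mul]
    simp only [Finset.mem_univ, if_true, Polynomial.derivative_add, Polynomial.derivative_C,
      Polynomial.derivative_C_mul, Polynomial.derivative_X, mul_one, zero_add]
    simp only [mul_add, Finset.sum_add_distrib, mul_assoc]
    rw [add_right_inj, mul_comm]

theorem MvPolynomial.exists_eq_smul_of_mul_pderiv_eq {K : Type*} [Field K] [CharZero K] {n : ℕ}
    (A B : MvPolynomial (Fin n) K) (hA : A ≠ 0)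
    (h : ∀ i, A * pderiv i B = B * pderiv i A) : ∃ c : K, B = c • A := by
  obtain ⟨x, hx⟩ : ∃ x, eval x A ≠ 0 := by
    by_contra! hcon
    exact hA (MvPolynomial.funext fun x => by simpa using hcon x)
  refine ⟨eval x B / eval x A, ?_⟩
  set E := B - (eval x B / eval x A) • A with hE
  have hE' : ∀ i, A * pderiv i E = E * pderiv i A := by
    intro i
    rw [hE, map_sub, Derivation.map_smul, mul_sub, sub_mul, h, mul_smul_comm, smul_mul_assoc]
  suffices E = 0 from sub_eq_zero.1 this
  have ev : ∀ (η : Fin n → K) (t : K) (P : MvPolynomial (Fin n) K), Polynomial.eval t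
      (aeval (fun h => Polynomial.C (x h) + Polynomial.C (η h) * Polynomial.X) P) =
      eval (fun h => x h + η h * t) P := by
    intro η t P
    rw [← Polynomial.coe_aeval_eq_eval, ← MvPolynomial.coe_aeval_eq_eval]
    rw [← AlgHom.comp_apply, MvPolynomial.comp_aeval]
    simp
  refine MvPolynomial.funext fun y => ?_
  have := Polynomial.eq_smul_of_mul_derivative_eq
    (A := aeval (fun h => Polynomial.C (x h) + Polynomial.C (y h - x h) * Polynomial.X) A)
    (B := aeval (fun h => Polynomial.C (x h) + Polynomial.C (y h - x h) * Polynomial.X) E)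
    (by rw [ev (fun h => y h - x h)]; simpa using hx)
    (by rw [ev (fun h => y h - x h)]; simp [hE, smul_eval, hx])
    (by
      rw [derivative_aeval_line x (fun h => y h - x h),
        derivative_aeval_line x (fun h => y h - x h),
        Finset.mul_sum, Finset.mul_sum]
      refine Finset.sum_congr rfl fun i _ => ?_
      rw [mul_left_comm, ← map_mul, hE', map_mul]; ring)
  have h2 := ev (fun h => y h - x h) 1 E
  rw [this] at h2
  simpa using h2.symm

namespace MvPolynomial

section Hasse

variable {σ R : Type*} [Fintype σ] [CommRing R]

/-- The multivariate Hasse derivative `(1 / I!) ∂^I`. -/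
noncomputable def hasse (I : σ →₀ ℕ) : MvPolynomial σ R →ₗ[R] MvPolynomial σ R :=
  (basisMonomials σ R).constr R fun J =>
    monomial (J - I) ((∏ h, (J h).choose (I h) : ℕ) : R)

theorem coeff_hasse (I K : σ →₀ ℕ) (P : MvPolynomial σ R) :
    coeff K (hasse I P) = ((∏ h, (K h + I h).choose (I h) : ℕ) : R) * coeff (K + I) P := by
  classical
  induction P using MvPolynomial.induction_on' with
  | monomial J a =>
    have h1 : (monomial J a : MvPolynomial σ R) = a • basisMonomials σ R J := by
      simp [coe_basisMonomials, smul_monomial]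
    rw [h1, map_smul, hasse, Module.Basis.constr_basis, coe_basisMonomials, coeff_smul, coeff_smul,
      coeff_monomial, coeff_monomial]
    by_cases hJ : J = K + I
    · subst hJ
      simp [mul_comm]
    · rw [if_neg hJ]
      by_cases hK : J - I = K
      · have : ∃ h, J h < I h := by
          by_contra! hcon
          apply hJ
          ext h
          have := DFunLike.congr_fun hK h
          have := hcon h
          simp only [Finsupp.tsub_apply, Finsupp.add_apply] at *
          omega
        obtain ⟨h, hh⟩ := this
        rw [if_pos hK, Finset.prod_eq_zero (Finset.mem_univ h) (Nat.choose_eq_zero_of_lt hh)]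
        simp
      · simp [hK]
  | add p q hp hq => rw [map_add, coeff_add, coeff_add, hp, hq, mul_add]

theorem hasse_zero (P : MvPolynomial σ R) : hasse 0 P = P := by
  ext K; simp [coeff_hasse]

theorem hasse_map {S : Type*} [CommRing S] (f : R →+* S) (I : σ →₀ ℕ) (P : MvPolynomial σ R) :
    hasse I (map f P) = map f (hasse I P) := by
  ext K; simp [coeff_hasse, coeff_map]

theorem pderiv_hasse (h : σ) (I : σ →₀ ℕ) (P : MvPolynomial σ R) :
    pderiv h (hasse I P) = ((I h + 1 : ℕ) : R) • hasse (I + Finsupp.single h 1) P := by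
  classical
  ext K
  rw [coeff_pderiv, coeff_hasse, coeff_smul, coeff_hasse, smul_eq_mul, mul_right_comm, ← mul_assoc,
    add_right_comm K, add_assoc K]
  congr 1
  rw [← Nat.cast_add_one, ← Nat.cast_mul, ← Nat.cast_mul]
  congr 1
  rw [← Finset.mul_prod_erase _ _ (Finset.mem_univ h),
    ← Finset.mul_prod_erase _ _ (Finset.mem_univ h)]
  have h1 : ∀ g ∈ Finset.univ.erase h, (((K + Finsupp.single h 1 : σ →₀ ℕ) g + I g).choose (I g)) =
      (K g + (I + Finsupp.single h 1 : σ →₀ ℕ) g).choose ((I + Finsupp.single h 1 : σ →₀ ℕ) g) := by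
    intro g hg
    have : g ≠ h := Finset.ne_of_mem_erase hg
    simp [Finsupp.single_eq_of_ne this]
  rw [Finset.prod_congr rfl h1]
  simp only [Finsupp.add_apply, Finsupp.single_eq_same]
  have h2 := Nat.add_one_mul_choose_eq (K h + I h) (I h)
  have h3 := Nat.choose_symm_add (a := K h + 1) (b := I h)
  have h4 : (K h + 1 + I h).choose (I h) * (K h + 1) =
      (I h + 1) * (K h + (I h + 1)).choose (I h + 1) := by
    have := Nat.choose_succ_right_eq (K h + I h + 1) (I h)
    rw [show K h + I h + 1 - I h = K h + 1 by omega] at this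
    rw [show K h + 1 + I h = K h + I h + 1 by omega, show K h + (I h + 1) = K h + I h + 1 by omega,
      ← this, mul_comm]
  rw [mul_right_comm, h4]; ring

/-- Translation of the variables by `ξ`. -/
noncomputable def translate (ξ : σ → R) : MvPolynomial σ R →ₐ[R] MvPolynomial σ R :=
  aeval fun h => X h + C (ξ h)

theorem pderiv_translate (ξ : σ → R) (h : σ) (P : MvPolynomial σ R) :
    pderiv h (translate ξ P) = translate ξ (pderiv h P) := by
  classical
  induction P using MvPolynomial.induction_on with
  | C a => simp [translate]
  | add p q hp hq => simp only [map_add, hp, hq]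
  | mul_X p i hp =>
    rw [map_mul, pderiv_mul, hp, pderiv_mul, map_add, map_mul, map_mul]
    congr 2
    simp only [translate, aeval_X, map_add, pderiv_C, add_zero, pderiv_X]
    by_cases hi : i = h
    · subst hi; simp
    · rw [Pi.single_eq_of_ne hi]; simp

theorem hasse_translate [IsDomain R] [CharZero R] (ξ : σ → R) (I : σ →₀ ℕ)
    (P : MvPolynomial σ R) : hasse I (translate ξ P) = translate ξ (hasse I P) := by
  classical
  obtain ⟨n, hn⟩ : ∃ n, ∑ h, I h = n := ⟨_, rfl⟩
  induction n generalizing I with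
  | zero =>
    have : I = 0 := by
      ext h
      exact Finset.sum_eq_zero_iff.1 hn h (Finset.mem_univ h)
    subst this
    simp [hasse_zero]
  | succ n ih =>
    obtain ⟨h, -, hh⟩ := Finset.exists_ne_zero_of_sum_ne_zero (by omega : ∑ h, I h ≠ 0)
    obtain ⟨I, rfl⟩ : ∃ I', I = I' + Finsupp.single h 1 :=
      ⟨I - Finsupp.single h 1, by
        rw [tsub_add_cancel_of_le]
        exact Finsupp.single_le_iff.2 (Nat.one_le_iff_ne_zero.2 hh)⟩
    have hI : ∑ h, I h = n := by
      have h1 : ∑ g, (Finsupp.single h 1 : σ →₀ ℕ) g = 1 := by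
        rw [Finset.sum_eq_single h (fun g _ hg => Finsupp.single_eq_of_ne hg) (by simp)]
        simp
      simp only [Finsupp.add_apply, Finset.sum_add_distrib, h1] at hn
      omega
    have e := congrArg (pderiv h) (ih I hI)
    rw [pderiv_hasse, pderiv_translate, pderiv_hasse, map_smul] at e
    exact smul_right_injective _ (Nat.cast_ne_zero.2 (Nat.succ_ne_zero _)) e

theorem coeff_translate [IsDomain R] [CharZero R] (ξ : σ → R) (I : σ →₀ ℕ)
    (P : MvPolynomial σ R) : coeff I (translate ξ P) = eval ξ (hasse I P) := by
  have h1 : coeff I (translate ξ P) = constantCoeff (hasse I (translate ξ P)) := by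
    simp [constantCoeff_eq, coeff_hasse]
  have h2 : constantCoeff.comp (translate ξ).toRingHom = eval ξ := by
    apply MvPolynomial.ringHom_ext <;> intro i <;> simp [translate]
  rw [h1, hasse_translate, ← h2]
  rfl

theorem degreeOf_hasse_le (h : σ) (I : σ →₀ ℕ) (P : MvPolynomial σ R) :
    degreeOf h (hasse I P) ≤ degreeOf h P := by
  classical
  rw [degreeOf_le_iff]
  intro K hK
  rw [mem_support_iff, coeff_hasse] at hK
  have := (degreeOf_le_iff (n := h) (f := P) (d := degreeOf h P)).1 le_rfl (K + I)
    (mem_support_iff.2 (right_ne_zero_of_mul hK))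
  simp only [Finsupp.add_apply] at this
  omega

end Hasse

section L1

variable {σ R : Type*} [NormedCommRing R]

/-- The sum of the norms of the coefficients. -/
noncomputable def l1 (P : MvPolynomial σ R) : ℝ := ∑ J ∈ P.support, ‖coeff J P‖

theorem l1_eq_sum {P : MvPolynomial σ R} {s : Finset (σ →₀ ℕ)} (hs : P.support ⊆ s) :
    l1 P = ∑ J ∈ s, ‖coeff J P‖ := by
  refine Finset.sum_subset hs fun J _ hJ => ?_
  simp [notMem_support_iff.1 hJ]

theorem l1_nonneg (P : MvPolynomial σ R) : 0 ≤ l1 P := Finset.sum_nonneg fun _ _ => norm_nonneg _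

theorem norm_coeff_le_l1 (J : σ →₀ ℕ) (P : MvPolynomial σ R) : ‖coeff J P‖ ≤ l1 P := by
  by_cases hJ : J ∈ P.support
  · exact Finset.single_le_sum (f := fun J => ‖coeff J P‖) (fun _ _ => norm_nonneg _) hJ
  · rw [notMem_support_iff.1 hJ, norm_zero]; exact l1_nonneg P

@[simp] theorem l1_zero : l1 (0 : MvPolynomial σ R) = 0 := by simp [l1]

theorem l1_add_le (P Q : MvPolynomial σ R) : l1 (P + Q) ≤ l1 P + l1 Q := by
  classical
  rw [l1_eq_sum (support_add (p := P) (q := Q)),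
    l1_eq_sum (Finset.subset_union_left (s₂ := Q.support)),
    l1_eq_sum (Finset.subset_union_right (s₁ := P.support)), ← Finset.sum_add_distrib]
  exact Finset.sum_le_sum fun J _ => by rw [coeff_add]; exact norm_add_le _ _

theorem l1_sum_le {ι : Type*} (s : Finset ι) (f : ι → MvPolynomial σ R) :
    l1 (∑ i ∈ s, f i) ≤ ∑ i ∈ s, l1 (f i) := by
  classical
  induction s using Finset.induction_on with
  | empty => simp
  | insert a s ha ih =>
    rw [Finset.sum_insert ha, Finset.sum_insert ha]
    exact (l1_add_le _ _).trans (by gcongr)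

theorem l1_monomial (J : σ →₀ ℕ) (c : R) : l1 (monomial J c) = ‖c‖ := by
  classical
  rw [l1_eq_sum (s := {J}) support_monomial_subset]
  simp

theorem l1_mul_le (P Q : MvPolynomial σ R) : l1 (P * Q) ≤ l1 P * l1 Q := by
  classical
  conv_lhs => rw [P.as_sum, Q.as_sum, Finset.sum_mul_sum]
  refine (l1_sum_le _ _).trans ?_
  rw [l1, l1, Finset.sum_mul_sum]
  refine Finset.sum_le_sum fun J _ => (l1_sum_le _ _).trans (Finset.sum_le_sum fun K _ => ?_)
  rw [monomial_mul, l1_monomial]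
  exact norm_mul_le _ _

theorem l1_C (c : R) : l1 (C c : MvPolynomial σ R) = ‖c‖ := l1_monomial 0 c

theorem l1_smul_le (c : R) (P : MvPolynomial σ R) : l1 (c • P) ≤ ‖c‖ * l1 P := by
  rw [smul_eq_C_mul]
  exact (l1_mul_le _ _).trans (by rw [l1_C])

theorem l1_prod_le [NormOneClass R] {ι : Type*} (s : Finset ι) (f : ι → MvPolynomial σ R) :
    l1 (∏ i ∈ s, f i) ≤ ∏ i ∈ s, l1 (f i) := by
  classical
  induction s using Finset.induction_on with
  | empty => rw [Finset.prod_empty, Finset.prod_empty, ← C_1, l1_C, norm_one]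
  | insert a s ha ih =>
    rw [Finset.prod_insert ha, Finset.prod_insert ha]
    exact (l1_mul_le _ _).trans (mul_le_mul_of_nonneg_left ih (l1_nonneg _))

theorem l1_pow_le [NormOneClass R] (P : MvPolynomial σ R) (n : ℕ) : l1 (P ^ n) ≤ l1 P ^ n := by
  simpa using l1_prod_le (Finset.range n) fun _ => P

theorem l1_det_le [NormOneClass R] {k : ℕ} (M : Matrix (Fin k) (Fin k) (MvPolynomial σ R)) {B : ℝ}
    (hB : ∀ i j, l1 (M i j) ≤ B) : l1 M.det ≤ (k.factorial : ℝ) * B ^ k := by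
  rw [Matrix.det_apply]
  refine (l1_sum_le _ _).trans ?_
  have : ∀ τ ∈ (Finset.univ : Finset (Equiv.Perm (Fin k))),
      l1 (Equiv.Perm.sign τ • ∏ i, M (τ i) i) ≤ B ^ k := by
    intro τ _
    have h1 : l1 (Equiv.Perm.sign τ • ∏ i, M (τ i) i) ≤ l1 (∏ i, M (τ i) i) := by
      rcases Int.units_eq_one_or (Equiv.Perm.sign τ) with h | h
      · simp [h]
      · rw [h, Units.neg_smul, one_smul, ← neg_one_smul R]
        refine (l1_smul_le _ _).trans ?_
        simp
    refine h1.trans ((l1_prod_le _ _).trans ?_)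
    refine (Finset.prod_le_prod (fun i _ => l1_nonneg _) fun i _ => hB (τ i) i).trans ?_
    simp
  refine (Finset.sum_le_sum this).trans ?_
  simp [Fintype.card_perm]

theorem l1_map {S : Type*} [NormedCommRing S] (f : R →+* S) (hf : ∀ a, ‖f a‖ = ‖a‖)
    (P : MvPolynomial σ R) : l1 (map f P) = l1 P := by
  rw [l1_eq_sum (support_map_subset f P), l1]
  simp [coeff_map, hf]

theorem prod_choose_le [Fintype σ] {r : σ → ℕ} {J I : σ →₀ ℕ} (hJ : ∀ h, J h ≤ r h) :
    ((∏ h, (J h).choose (I h) : ℕ) : ℝ) ≤ 2 ^ ∑ h, r h := by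
  rw [← Finset.prod_pow_eq_pow_sum]
  push_cast
  refine Finset.prod_le_prod (fun _ _ => by positivity) fun h _ => ?_
  have h1 : ((J h).choose (I h) : ℝ) ≤ 2 ^ J h := by exact_mod_cast Nat.choose_le_two_pow _ _
  exact h1.trans (pow_le_pow_right₀ one_le_two (hJ h))

theorem l1_hasse_le [NormOneClass R] [Fintype σ] {r : σ → ℕ} {P : MvPolynomial σ R}
    (hP : ∀ h, degreeOf h P ≤ r h) (I : σ →₀ ℕ) :
    l1 (hasse I P) ≤ 2 ^ (∑ h, r h) * l1 P := by
  classical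
  have h1 : l1 (hasse I P) = ∑ K ∈ (hasse I P).support.map (addRightEmbedding I),
      ‖((∏ h, (K h).choose (I h) : ℕ) : R) * coeff K P‖ := by
    rw [Finset.sum_map]
    refine Finset.sum_congr rfl fun K _ => ?_
    rw [coeff_hasse]; rfl
  have h2 : (hasse I P).support.map (addRightEmbedding I) ⊆ P.support := by
    intro K hK
    rw [Finset.mem_map] at hK
    obtain ⟨J, hJ, rfl⟩ := hK
    rw [mem_support_iff, coeff_hasse] at hJ
    exact mem_support_iff.2 (right_ne_zero_of_mul hJ)
  rw [h1, l1, Finset.mul_sum]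
  refine (Finset.sum_le_sum_of_subset_of_nonneg h2 fun _ _ _ => norm_nonneg _).trans ?_
  refine Finset.sum_le_sum fun K hK => (norm_mul_le _ _).trans ?_
  gcongr
  have h3 : ‖((∏ h, (K h).choose (I h) : ℕ) : R)‖ ≤ ((∏ h, (K h).choose (I h) : ℕ) : ℝ) := by
    simpa using Nat.norm_cast_le (α := R) (∏ h, (K h).choose (I h))
  exact h3.trans (prod_choose_le fun h => (degreeOf_le_iff.1 (hP h)) K hK)

end L1

section Order

variable {σ R : Type*} [Fintype σ] [CommRing R]

/-- The weight of the exponent `I`, where the `h`-th variable has weight `1 / r h`. -/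
noncomputable def wt (r : σ → ℕ) (I : σ →₀ ℕ) : ℝ := ∑ h, (I h : ℝ) / r h

theorem wt_nonneg (r : σ → ℕ) (I : σ →₀ ℕ) : 0 ≤ wt r I :=
  Finset.sum_nonneg fun _ _ => by positivity

theorem wt_add (r : σ → ℕ) (I J : σ →₀ ℕ) : wt r (I + J) = wt r I + wt r J := by
  simp [wt, add_div, Finset.sum_add_distrib]

/-- All monomials of `P` have weight at least `t`: the index of `P` at the origin is at
least `t`. -/
def OrdGE (r : σ → ℕ) (t : ℝ) (P : MvPolynomial σ R) : Prop := ∀ I, coeff I P ≠ 0 → t ≤ wt r I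

variable {r : σ → ℕ}

theorem ordGE_of_nonpos {t : ℝ} (ht : t ≤ 0) (P : MvPolynomial σ R) : OrdGE r t P :=
  fun I _ => ht.trans (wt_nonneg r I)

theorem OrdGE.mono {s t : ℝ} {P : MvPolynomial σ R} (h : OrdGE r t P) (hs : s ≤ t) :
    OrdGE r s P := fun I hI => hs.trans (h I hI)

theorem OrdGE.sum {ι : Type*} {s : Finset ι} {f : ι → MvPolynomial σ R} {t : ℝ}
    (h : ∀ i ∈ s, OrdGE r t (f i)) : OrdGE r t (∑ i ∈ s, f i) := by
  intro I hI
  rw [coeff_sum] at hI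
  obtain ⟨i, hi, hi'⟩ := Finset.exists_ne_zero_of_sum_ne_zero hI
  exact h i hi I hi'

theorem OrdGE.mul {P Q : MvPolynomial σ R} {s t : ℝ} (hP : OrdGE r s P) (hQ : OrdGE r t Q) :
    OrdGE r (s + t) (P * Q) := by
  classical
  intro I hI
  rw [coeff_mul] at hI
  obtain ⟨⟨J, K⟩, hJK, h⟩ := Finset.exists_ne_zero_of_sum_ne_zero hI
  rw [Finset.HasAntidiagonal.mem_antidiagonal] at hJK
  rw [← hJK, wt_add]
  exact add_le_add (hP J (left_ne_zero_of_mul h)) (hQ K (right_ne_zero_of_mul h))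

theorem OrdGE.smul {S : Type*} [DistribSMul S R] {P : MvPolynomial σ R} {t : ℝ} (hP : OrdGE r t P)
    (c : S) : OrdGE r t (c • P) := by
  intro I hI
  refine hP I fun h => hI ?_
  rw [coeff_smul, h, smul_zero]

theorem OrdGE.prod {ι : Type*} {s : Finset ι} {f : ι → MvPolynomial σ R} {t : ι → ℝ}
    (h : ∀ i ∈ s, OrdGE r (t i) (f i)) : OrdGE r (∑ i ∈ s, t i) (∏ i ∈ s, f i) := by
  classical
  induction s using Finset.induction_on with
  | empty => exact ordGE_of_nonpos (by simp) _
  | insert a s ha ih =>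
    rw [Finset.sum_insert ha, Finset.prod_insert ha]
    exact (h a (by simp)).mul (ih fun i hi => h i (by simp [hi]))

theorem OrdGE.det {k : ℕ} {M : Matrix (Fin k) (Fin k) (MvPolynomial σ R)} {t : Fin k → ℝ}
    (h : ∀ i j, OrdGE r (t j) (M i j)) : OrdGE r (∑ j, t j) M.det := by
  rw [Matrix.det_apply]
  refine OrdGE.sum fun τ _ => ?_
  rw [Units.smul_def]
  exact (OrdGE.prod fun j _ => h (τ j) j).smul _

theorem OrdGE.hasse {P : MvPolynomial σ R} {t : ℝ} (hP : OrdGE r t P) (I : σ →₀ ℕ) :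
    OrdGE r (t - wt r I) (hasse I P) := by
  intro K hK
  rw [coeff_hasse] at hK
  have := hP _ (right_ne_zero_of_mul hK)
  rw [wt_add] at this
  linarith

end Order

end MvPolynomial

namespace MvPolynomial

section Tensor

variable {K : Type*} [CommRing K] {n : ℕ}

/-- The product of a polynomial in the variables `1, …, n` and a polynomial in the variable `0`. -/
noncomputable def tensor (φ : MvPolynomial (Fin n) K) (ψ : Polynomial K) :
    MvPolynomial (Fin (n + 1)) K := rename Fin.succ φ * Polynomial.aeval (X 0) ψ

theorem finSuccEquiv_tensor (φ : MvPolynomial (Fin n) K) (ψ : Polynomial K) :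
    finSuccEquiv K n (tensor φ ψ) = Polynomial.C φ * ψ.map C := by
  rw [tensor, map_mul]
  congr 1
  · induction φ using MvPolynomial.induction_on with
    | C a =>
      rw [rename_C]
      exact ((finSuccEquiv K n).symm_apply_eq.1
          (RingHom.congr_fun (finSuccEquiv_comp_C_eq_C n) a)).symm
    | add p q hp hq => simp only [map_add, hp, hq]
    | mul_X p i hp => rw [map_mul, map_mul, hp, rename_X, finSuccEquiv_X_succ, Polynomial.C_mul]
  · rw [← Polynomial.aeval_algHom_apply, finSuccEquiv_X_zero, Polynomial.aeval_def]
    rfl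

theorem coeff_cons_tensor (φ : MvPolynomial (Fin n) K) (ψ : Polynomial K) (j : ℕ)
    (I : Fin n →₀ ℕ) : coeff (I.cons j) (tensor φ ψ) = coeff I φ * ψ.coeff j := by
  rw [← finSuccEquiv_coeff_coeff, finSuccEquiv_tensor, Polynomial.coeff_C_mul, Polynomial.coeff_map,
    mul_comm, coeff_C_mul, mul_comm]

theorem ext_cons {P Q : MvPolynomial (Fin (n + 1)) K}
    (h : ∀ (j : ℕ) (I : Fin n →₀ ℕ), coeff (I.cons j) P = coeff (I.cons j) Q) : P = Q := by
  ext J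
  rw [← Finsupp.cons_tail J]
  exact h _ _

theorem hasse_tensor (φ : MvPolynomial (Fin n) K) (ψ : Polynomial K) (j : ℕ) (I : Fin n →₀ ℕ) :
    hasse (I.cons j) (tensor φ ψ) = tensor (hasse I φ) (Polynomial.hasseDeriv j ψ) := by
  refine ext_cons fun l J => ?_
  have h1 : (Finsupp.cons l J + Finsupp.cons j I : Fin (n + 1) →₀ ℕ) =
      Finsupp.cons (l + j) (J + I) := by
    ext h
    refine Fin.cases ?_ (fun h => ?_) h <;> simp
  rw [coeff_hasse, h1, coeff_cons_tensor, coeff_cons_tensor, coeff_hasse,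
    Polynomial.hasseDeriv_coeff, Fin.prod_univ_succ]
  simp only [Finsupp.cons_zero, Finsupp.cons_succ]
  push_cast
  ring

theorem translate_tensor (ξ : Fin (n + 1) → K) (φ : MvPolynomial (Fin n) K) (ψ : Polynomial K) :
    translate ξ (tensor φ ψ) =
      tensor (translate (fun h => ξ h.succ) φ) (Polynomial.taylor (ξ 0) ψ) := by
  rw [tensor, tensor, map_mul]
  congr 1
  · induction φ using MvPolynomial.induction_on with
    | C a => simp [translate]
    | add p q hp hq => simp only [map_add, hp, hq]
    | mul_X p i hp =>
      simp only [map_mul, hp, rename_X]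
      congr 1
      simp [translate]
  · rw [← Polynomial.aeval_algHom_apply, Polynomial.taylor_apply, Polynomial.aeval_comp]
    congr 1
    simp [translate]

theorem tensor_sum_left {ι : Type*} (s : Finset ι) (φ : ι → MvPolynomial (Fin n) K)
    (ψ : Polynomial K) : tensor (∑ i ∈ s, φ i) ψ = ∑ i ∈ s, tensor (φ i) ψ := by
  simp [tensor, Finset.sum_mul]

theorem tensor_add_left (φ φ' : MvPolynomial (Fin n) K)
    (ψ : Polynomial K) : tensor (φ + φ') ψ = tensor φ ψ + tensor φ' ψ := by
  simp [tensor, add_mul]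

theorem tensor_add_right (φ : MvPolynomial (Fin n) K)
    (ψ ψ' : Polynomial K) : tensor φ (ψ + ψ') = tensor φ ψ + tensor φ ψ' := by
  simp [tensor, mul_add]

theorem tensor_sum_right {ι : Type*} (s : Finset ι) (φ : MvPolynomial (Fin n) K)
    (ψ : ι → Polynomial K) : tensor φ (∑ i ∈ s, ψ i) = ∑ i ∈ s, tensor φ (ψ i) := by
  simp [tensor, Finset.mul_sum]

theorem tensor_smul_left (c : K) (φ : MvPolynomial (Fin n) K) (ψ : Polynomial K) :
    tensor (c • φ) ψ = c • tensor φ ψ := by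
  simp [tensor]

theorem tensor_smul_right (c : K) (φ : MvPolynomial (Fin n) K) (ψ : Polynomial K) :
    tensor φ (c • ψ) = c • tensor φ ψ := by
  simp [tensor]

theorem det_tensor {k : ℕ} (φ : Fin k → Fin k → MvPolynomial (Fin n) K)
    (ψ : Fin k → Fin k → Polynomial K) :
    (Matrix.of fun i j => ∑ l, tensor (φ i l) (ψ j l)).det =
      tensor (Matrix.of φ).det (Matrix.of ψ).det := by
  have h1 : (Matrix.of fun i j => ∑ l, tensor (φ i l) (ψ j l)) =
      (rename (Fin.succ : Fin n → Fin (n + 1))).mapMatrix (Matrix.of φ) *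
        ((Polynomial.aeval (X 0 : MvPolynomial (Fin (n + 1)) K)).mapMatrix
          (Matrix.of ψ)).transpose := by
    ext1 i j
    simp [Matrix.mul_apply, tensor]
  rw [h1, Matrix.det_mul, Matrix.det_transpose, ← AlgHom.map_det, ← AlgHom.map_det, tensor]

end Tensor

theorem exists_linearIndependent_tensor {K : Type*} [Field K] {n d : ℕ}
    (P : MvPolynomial (Fin (n + 1)) K) (hd : degreeOf 0 P ≤ d) :
    ∃ (k : ℕ) (φ : Fin k → MvPolynomial (Fin n) K) (ψ : Fin k → Polynomial K), k ≤ d + 1 ∧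
      LinearIndependent K φ ∧ LinearIndependent K ψ ∧ P = ∑ l, tensor (φ l) (ψ l) := by
  classical
  have hex : ∃ k, ∃ (φ : Fin k → MvPolynomial (Fin n) K) (ψ : Fin k → Polynomial K),
      P = ∑ l, tensor (φ l) (ψ l) ∧ k ≤ d + 1 := by
    refine ⟨d + 1, fun l => (finSuccEquiv K n P).coeff l, fun l => Polynomial.X ^ (l : ℕ),
      ext_cons fun j I => ?_, le_rfl⟩
    simp only [coeff_sum, coeff_cons_tensor, Polynomial.coeff_X_pow, mul_ite, mul_one, mul_zero,
      finSuccEquiv_coeff_coeff]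
    by_cases hj : j < d + 1
    · rw [Finset.sum_eq_single (⟨j, hj⟩ : Fin (d + 1))]
      · simp
      · intro b _ hb
        rw [if_neg]
        rintro rfl
        exact hb rfl
      · simp
    · rw [Finset.sum_eq_zero]
      · by_contra hcon
        have := degreeOf_le_iff.1 hd _ (mem_support_iff.2 hcon)
        rw [Finsupp.cons_zero] at this
        omega
      · intro b _
        rw [if_neg]
        rintro rfl
        exact hj b.2
  obtain ⟨φ, ψ, hP, hk⟩ := Nat.find_spec hex
  have hmin : ∀ m, m < Nat.find hex → ∀ (φ : Fin m → MvPolynomial (Fin n) K)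
      (ψ : Fin m → Polynomial K), P ≠ ∑ l, tensor (φ l) (ψ l) := by
    intro m hm φ ψ h
    exact Nat.find_min hex hm ⟨φ, ψ, h, by omega⟩
  generalize Nat.find hex = k at *
  refine ⟨k, φ, ψ, hk, ?_, ?_, hP⟩
  · by_contra hli
    obtain ⟨g, hg, i, hi⟩ := Fintype.not_linearIndependent_iff.1 hli
    obtain ⟨k, rfl⟩ : ∃ k', k = k' + 1 := ⟨k - 1, by have := i.2; omega⟩
    rw [Fin.sum_univ_succAbove _ i] at hg hP
    have h1 : φ i = ∑ l, (-(g (i.succAbove l)) / g i) • φ (i.succAbove l) := by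
      have h2 : g i • φ i = - ∑ l, g (i.succAbove l) • φ (i.succAbove l) :=
        eq_neg_of_add_eq_zero_left hg
      rw [← inv_smul_smul₀ hi (φ i), h2, ← Finset.sum_neg_distrib, Finset.smul_sum]
      refine Finset.sum_congr rfl fun l _ => ?_
      rw [← neg_smul, smul_smul]
      congr 1; ring
    refine hmin k (by omega) (fun l => φ (i.succAbove l))
      (fun l => ψ (i.succAbove l) + (-(g (i.succAbove l)) / g i) • ψ i) ?_
    conv_lhs => rw [hP, h1, tensor_sum_left, ← Finset.sum_add_distrib]
    refine Finset.sum_congr rfl fun l _ => ?_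
    rw [tensor_add_right, tensor_smul_left, tensor_smul_right]
    exact add_comm _ _
  · by_contra hli
    obtain ⟨g, hg, i, hi⟩ := Fintype.not_linearIndependent_iff.1 hli
    obtain ⟨k, rfl⟩ : ∃ k', k = k' + 1 := ⟨k - 1, by have := i.2; omega⟩
    rw [Fin.sum_univ_succAbove _ i] at hg hP
    have h1 : ψ i = ∑ l, (-(g (i.succAbove l)) / g i) • ψ (i.succAbove l) := by
      have h2 : g i • ψ i = - ∑ l, g (i.succAbove l) • ψ (i.succAbove l) :=
        eq_neg_of_add_eq_zero_left hg
      rw [← inv_smul_smul₀ hi (ψ i), h2, ← Finset.sum_neg_distrib, Finset.smul_sum]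
      refine Finset.sum_congr rfl fun l _ => ?_
      rw [← neg_smul, smul_smul]
      congr 1; ring
    refine hmin k (by omega) (fun l => φ (i.succAbove l) + (-(g (i.succAbove l)) / g i) • φ i)
      (fun l => ψ (i.succAbove l)) ?_
    conv_lhs => rw [hP, h1, tensor_sum_right, ← Finset.sum_add_distrib]
    refine Finset.sum_congr rfl fun l _ => ?_
    rw [tensor_add_left, tensor_smul_left, tensor_smul_right]
    exact add_comm _ _

theorem exists_hasse_wronskian_ne_zero {K : Type*} [Field K] [CharZero K] {n k : ℕ}
    (φ : Fin k → MvPolynomial (Fin n) K) (hφ : LinearIndependent K φ) :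
    ∃ b : Fin k → (Fin n →₀ ℕ), (∀ i, ∑ h, b i h ≤ i) ∧
      (Matrix.of fun i j => hasse (b i) (φ j)).det ≠ 0 := by
  refine exists_wronskian_ne_zero hasse (fun b => ∑ h, b h) 0 (by simp) hasse_zero
    (fun h : Fin n => pderiv h) (fun h b => ⟨b + Finsupp.single h 1, C ((b h + 1 : ℕ) : K), ?_, ?_⟩)
    (fun A B hA h => exists_eq_smul_of_mul_pderiv_eq A B hA h) k φ hφ
  · simp [Finset.sum_add_distrib, Finsupp.single_apply]
  · intro f
    rw [pderiv_hasse, smul_eq_C_mul]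

end MvPolynomial

theorem Polynomial.exists_hasse_wronskian_ne_zero {K : Type*} [Field K] [CharZero K] {k : ℕ}
    (ψ : Fin k → Polynomial K) (hψ : LinearIndependent K ψ) :
    ∃ b : Fin k → ℕ, (∀ i, b i ≤ i) ∧ (Matrix.of fun i j => hasseDeriv (b i) (ψ j)).det ≠ 0 := by
  refine exists_wronskian_ne_zero (fun b : ℕ => hasseDeriv b) id 0 rfl (by simp)
    (fun _ : Unit => derivative') (fun _ b => ⟨b + 1, ((b + 1 : ℕ) : Polynomial K), rfl, ?_⟩)
    (fun A B hA h => exists_eq_smul_of_mul_derivative_eq A B hA (h ())) k ψ hψ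
  intro f
  have h1 := LinearMap.congr_fun (hasseDeriv_comp 1 b (R := K)) f
  rw [LinearMap.comp_apply, hasseDeriv_one, add_comm 1 b, Nat.choose_one_right] at h1
  simpa [add_mul] using h1

theorem Polynomial.exists_coeff_taylor_ne_zero {Q : Polynomial ℤ} (hQ : Q ≠ 0) {p : ℤ} {q : ℕ}
    (hq : 0 < q) (hpq : IsCoprime p (q : ℤ)) :
    ∃ l : ℕ, (taylor ((p : ℚ) / q) (Q.map (Int.castRingHom ℚ))).coeff l ≠ 0 ∧
      (q : ℤ) ^ l ≤ |Q.leadingCoeff| := by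
  have hq0 : (q : ℚ) ≠ 0 := by positivity
  set l := (Q.map (Int.castRingHom ℚ)).rootMultiplicity ((p : ℚ) / q) with hl
  have hQ' : Q.map (Int.castRingHom ℚ) ≠ 0 := (Polynomial.map_ne_zero_iff Int.cast_injective).2 hQ
  refine ⟨l, ?_, ?_⟩
  · rw [hl, rootMultiplicity_eq_natTrailingDegree, ← taylor_apply]
    have : taylor ((p : ℚ) / q) (Q.map (Int.castRingHom ℚ)) ≠ 0 := by
      simpa using hQ'
    exact trailingCoeff_nonzero_iff_nonzero.2 this
  · have hprim : (C (q : ℤ) * X - C p).IsPrimitive := by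
      intro r hr
      have h1 := (C_dvd_iff_dvd_coeff _ _).1 hr
      have h2 := h1 0
      have h3 := h1 1
      rw [coeff_sub, coeff_C_mul, coeff_X_zero, mul_zero, coeff_C_zero, zero_sub, dvd_neg] at h2
      rw [coeff_sub, coeff_C_mul, coeff_X_one, mul_one, coeff_C_of_ne_zero one_ne_zero,
        sub_zero] at h3
      obtain ⟨u, v, huv⟩ := hpq
      exact isUnit_of_dvd_one (huv ▸ dvd_add (h2.mul_left u) (h3.mul_left v))
    have hpow : ∀ m : ℕ, ((C (q : ℤ) * X - C p) ^ m).IsPrimitive := by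
      intro m
      induction m with
      | zero => simp
      | succ m ih => rw [pow_succ]; exact ih.mul hprim
    have hdvd : ((C (q : ℤ) * X - C p) ^ l).map (Int.castRingHom ℚ) ∣
        Q.map (Int.castRingHom ℚ) := by
      have h1 : ((C (q : ℤ) * X - C p) ^ l).map (Int.castRingHom ℚ) =
          C ((q : ℚ) ^ l) * (X - C ((p : ℚ) / q)) ^ l := by
        rw [Polynomial.map_pow, C_pow, ← mul_pow]
        congr 1
        simp only [Polynomial.map_sub, Polynomial.map_mul, map_C, map_X, mul_sub, ← C_mul]
        rw [mul_div_cancel₀ _ hq0]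
        simp
      have h2 : (X - C ((p : ℚ) / q)) ^ l ∣ Q.map (Int.castRingHom ℚ) :=
        pow_rootMultiplicity_dvd _ _
      rw [h1, IsUnit.mul_left_dvd (isUnit_C.2 (isUnit_iff_ne_zero.2 (pow_ne_zero _ hq0)))]
      exact h2
    have h4 := (IsPrimitive.Int.dvd_iff_map_cast_dvd_map_cast _ _ (hpow l)).2 hdvd
    have h5 := leadingCoeff_dvd_leadingCoeff h4
    have h6 : (C (q : ℤ) * X - C p).leadingCoeff = (q : ℤ) := by
      rw [sub_eq_add_neg, ← C_neg]
      exact leadingCoeff_linear (by exact_mod_cast hq.ne')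
    rw [leadingCoeff_pow, h6] at h5
    exact Int.le_of_dvd (abs_pos.2 (leadingCoeff_ne_zero.2 hQ)) ((dvd_abs _ _).2 h5)

namespace MvPolynomial

theorem degreeOf_det_le {σ R : Type*} [CommRing R] {k d : ℕ} {h : σ}
    {M : Matrix (Fin k) (Fin k) (MvPolynomial σ R)} (hM : ∀ i j, degreeOf h (M i j) ≤ d) :
    degreeOf h M.det ≤ k * d := by
  rw [Matrix.det_apply]
  refine (degreeOf_sum_le _ _ _).trans (Finset.sup_le fun τ _ => ?_)
  have h1 : degreeOf h (∏ i, M (τ i) i) ≤ k * d :=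
    (degreeOf_prod_le _ _ _).trans ((Finset.sum_le_sum fun i _ => hM _ i).trans (by simp))
  rcases Int.units_eq_one_or (Equiv.Perm.sign τ) with h2 | h2
  · rwa [h2, one_smul]
  · rwa [h2, Units.neg_smul, one_smul, degreeOf_neg]

theorem exists_map_det_eq_tensor {n d : ℕ} {P : MvPolynomial (Fin (n + 1)) ℤ} (hP : P ≠ 0)
    (hd : degreeOf 0 P ≤ d) :
    ∃ (k : ℕ) (b : Fin k → (Fin n →₀ ℕ)) (c : Fin k → ℕ) (U : MvPolynomial (Fin n) ℚ)
      (V : Polynomial ℚ), 0 < k ∧ k ≤ d + 1 ∧ (∀ i, ∑ h, b i h ≤ i) ∧ (∀ j, c j ≤ j) ∧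
      U ≠ 0 ∧ V ≠ 0 ∧
      map (Int.castRingHom ℚ) (Matrix.of fun i j => hasse ((b i).cons (c j)) P).det =
        tensor U V := by
  have hP' : map (Int.castRingHom ℚ) P ≠ 0 := by
    rwa [Ne, map_eq_zero_iff _ (map_injective _ Int.cast_injective)]
  obtain ⟨k, φ, ψ, hk, hφ, hψ, hsum⟩ := exists_linearIndependent_tensor
    (map (Int.castRingHom ℚ) P) (d := d)
    (degreeOf_le_iff.2 fun m hm => degreeOf_le_iff.1 hd m (support_map_subset _ _ hm))
  obtain ⟨b, hb, hU⟩ := exists_hasse_wronskian_ne_zero φ hφ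
  obtain ⟨c, hc, hV⟩ := Polynomial.exists_hasse_wronskian_ne_zero ψ hψ
  refine ⟨k, b, c, _, _, ?_, hk, hb, hc, hU, hV, ?_⟩
  · rcases Nat.eq_zero_or_pos k with rfl | h
    · simp [hP'] at hsum
    · exact h
  · rw [RingHom.map_det]
    have := det_tensor (fun i j => hasse (b i) (φ j)) (fun i j => Polynomial.hasseDeriv (c i) (ψ j))
    rw [← this]
    congr 1
    ext1 i j
    simp only [RingHom.mapMatrix_apply, Matrix.map_apply, Matrix.of_apply]
    rw [← hasse_map, hsum, map_sum]
    simp only [hasse_tensor]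

theorem exists_int_of_map_eq_tensor {n : ℕ} {W : MvPolynomial (Fin (n + 1)) ℤ}
    {U : MvPolynomial (Fin n) ℚ} {V : Polynomial ℚ} (hU : U ≠ 0) (hV : V ≠ 0)
    (h : map (Int.castRingHom ℚ) W = tensor U V) :
    ∃ (U' : MvPolynomial (Fin n) ℤ) (V' : Polynomial ℤ) (a b : ℚ), U' ≠ 0 ∧ V' ≠ 0 ∧
      map (Int.castRingHom ℚ) U' = a • U ∧ V'.map (Int.castRingHom ℚ) = b • V ∧
      l1 U' ≤ l1 W ∧ (∀ h, degreeOf h U' ≤ degreeOf h.succ W) ∧ |(V'.leadingCoeff : ℝ)| ≤ l1 W := by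
  classical
  obtain ⟨I, hI⟩ := ne_zero_iff.1 hU
  obtain ⟨j, hj⟩ : ∃ j, V.coeff j ≠ 0 := by
    by_contra! hcon
    exact hV (Polynomial.ext hcon)
  have hW : ∀ j I, ((coeff (Finsupp.cons j I) W : ℤ) : ℚ) = coeff I U * V.coeff j := by
    intro j I
    rw [← coeff_cons_tensor, ← h, coeff_map]
    rfl
  have hVc : ∀ l, (∑ j ∈ (finSuccEquiv ℤ n W).support,
      Polynomial.monomial j (coeff I ((finSuccEquiv ℤ n W).coeff j))).coeff l =
        coeff (Finsupp.cons l I) W := by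
    intro l
    simp only [Polynomial.finsetSum_coeff, Polynomial.coeff_monomial, Finset.sum_ite_eq',
      Polynomial.mem_support_iff, ← finSuccEquiv_coeff_coeff]
    split_ifs with h
    · rfl
    · simp [not_not.1 h]
  set U' := (finSuccEquiv ℤ n W).coeff j with hU'
  set V' := ∑ j ∈ (finSuccEquiv ℤ n W).support,
      Polynomial.monomial j (coeff I ((finSuccEquiv ℤ n W).coeff j)) with hV'
  have hUm : map (Int.castRingHom ℚ) U' = V.coeff j • U := by
    ext J
    rw [coeff_map, finSuccEquiv_coeff_coeff, coeff_smul, smul_eq_mul, mul_comm]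
    exact hW j J
  have hVm : V'.map (Int.castRingHom ℚ) = coeff I U • V := by
    ext l
    rw [Polynomial.coeff_map, hVc, Polynomial.coeff_smul, smul_eq_mul]
    exact hW l I
  refine ⟨U', V', _, _, ?_, ?_, hUm, hVm, ?_, fun h => degreeOf_coeff_finSuccEquiv W h j, ?_⟩
  · rintro h0
    rw [h0, map_zero] at hUm
    exact smul_ne_zero hj hU hUm.symm
  · rintro h0
    rw [h0, Polynomial.map_zero] at hVm
    exact smul_ne_zero hI hV hVm.symm
  · have : l1 U' = ∑ J ∈ U'.support.image (Finsupp.cons j), ‖coeff J W‖ := by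
      rw [Finset.sum_image (fun _ _ _ _ h => Finsupp.cons_right_injective _ h)]
      simp only [l1, hU', finSuccEquiv_coeff_coeff]
    rw [this]
    refine Finset.sum_le_sum_of_subset_of_nonneg ?_ fun _ _ _ => norm_nonneg _
    intro J hJ
    obtain ⟨J', hJ', rfl⟩ := Finset.mem_image.1 hJ
    rw [mem_support_iff, hU', finSuccEquiv_coeff_coeff] at hJ'
    exact mem_support_iff.2 hJ'
  · rw [Polynomial.leadingCoeff, hVc, ← Int.norm_eq_abs]
    exact norm_coeff_le_l1 _ _

end MvPolynomial

theorem sq_le_sum_max_sub_div {k r : ℕ} (hr : 0 < r) (hkr : k ≤ r + 1) {e : ℝ}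
    (he : 0 < e) (he1 : e ≤ 1) : k * e ^ 2 / 8 ≤ ∑ j : Fin k, max 0 (e - (j : ℕ) / r) := by
  have hr' : (0 : ℝ) < r := by exact_mod_cast hr
  have hr1 : (1 : ℝ) ≤ r := by exact_mod_cast hr
  have hkr' : (k : ℝ) ≤ r + 1 := by exact_mod_cast hkr
  rw [Fin.sum_univ_eq_sum_range (fun j : ℕ => max 0 (e - (j : ℝ) / r)) k]
  set s := min k (⌊r * e / 2⌋₊ + 1) with hs
  have h1 : (k : ℝ) * e / 4 ≤ s := by
    have h2 : r * e / 2 < ⌊r * e / 2⌋₊ + 1 := Nat.lt_floor_add_one _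
    rw [hs, Nat.cast_min, le_min_iff]
    push_cast
    constructor
    · nlinarith [Nat.cast_nonneg (α := ℝ) k]
    · nlinarith
  calc (k : ℝ) * e ^ 2 / 8 ≤ s * (e / 2) := by nlinarith
    _ = ∑ j ∈ Finset.range s, e / 2 := by simp
    _ ≤ ∑ j ∈ Finset.range s, max 0 (e - (j : ℝ) / r) := by
        refine Finset.sum_le_sum fun j hj => le_max_of_le_right ?_
        have h3 : j ≤ ⌊r * e / 2⌋₊ := by have := Finset.mem_range.1 hj; omega
        have h4 : (j : ℝ) ≤ r * e / 2 := (Nat.cast_le.2 h3).trans (Nat.floor_le (by positivity))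
        have : (j : ℝ) / r ≤ e / 2 := by
          rw [div_le_iff₀ hr']; linarith
        linarith
    _ ≤ ∑ j ∈ Finset.range k, max 0 (e - (j : ℝ) / r) :=
        Finset.sum_le_sum_of_subset_of_nonneg (Finset.range_mono (min_le_left _ _))
          fun _ _ _ => le_max_left _ _

section

open MvPolynomial in
/-- The conclusion of Roth's lemma in `n` variables: a nonzero integer polynomial of degree at most
`r h` in the variable `h` with small coefficients has index at most `ε` at `p / q`. -/
def RothLemma (n : ℕ) (ε ω : ℝ) : Prop :=
  ∀ (r : Fin n → ℕ) (p : Fin n → ℤ) (q : Fin n → ℕ) (L : ℝ) (P : MvPolynomial (Fin n) ℤ),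
    P ≠ 0 → (∀ h, 0 < r h) → (∀ h, 0 < q h) → (∀ h, IsCoprime (p h) (q h : ℤ)) → 0 < L →
    (∀ h, L ≤ r h * Real.log (q h)) → ∑ h, (r h : ℝ) ≤ ω * L →
    (∀ i j, i < j → (r i : ℝ) ≤ ω * r j) → (∀ h, degreeOf h P ≤ r h) →
    l1 P ≤ Real.exp (ω * L) →
    ∃ I, coeff I (translate (fun h => (p h : ℚ) / q h) (map (Int.castRingHom ℚ) P)) ≠ 0 ∧
      wt r I ≤ ε

open MvPolynomial

theorem wt_cons {n : ℕ} (r : Fin (n + 1) → ℕ) (j : ℕ) (I : Fin n →₀ ℕ) :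
    wt r (I.cons j) = (j : ℝ) / r 0 + wt (fun h => r h.succ) I := by
  simp [wt, Fin.sum_univ_succ]

theorem RothLemma.succ {n : ℕ} {ε ω' ω : ℝ} (hε : 0 < ε) (hε1 : ε ≤ 1)
    (h : RothLemma n (ε ^ 2 / 100) ω') (hω : 0 < ω) (h1 : ω ≤ ε / 2) (h2 : 3 * ω ≤ ω')
    (h3 : 3 * ω ≤ ε ^ 2 / 100) : RothLemma (n + 1) ε ω := by
  intro r p q L P hP hr hq hpq hL hLq hsum hord hdeg hl1
  obtain ⟨k, b, c, U, V, hk0, hk, hb, hc, hU, hV, hW⟩ :=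
    exists_map_det_eq_tensor hP (hdeg 0)
  set W := (Matrix.of fun i j => hasse ((b i).cons (c j)) P).det with hWdef
  obtain ⟨U', V', a, a', hU', hV', hUm, hVm, hUl, hUd, hVl⟩ := exists_int_of_map_eq_tensor hU hV hW
  have hk0' : (0 : ℝ) < k := by exact_mod_cast hk0
  have hk1' : (k : ℝ) ≤ r 0 + 1 := by exact_mod_cast hk
  have hr' : ∀ h, (0 : ℝ) < r h := fun h => by exact_mod_cast hr h
  have hr0 : (r 0 : ℝ) ≤ ∑ h, (r h : ℝ) :=
    Finset.single_le_sum (f := fun h => (r h : ℝ)) (fun h _ => (hr' h).le) (Finset.mem_univ 0)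
  have hWl : l1 W ≤ Real.exp (3 * ω * (k * L)) := by
    have h4 : l1 W ≤ (k.factorial : ℝ) * (2 ^ (∑ h, r h) * l1 P) ^ k :=
      l1_det_le _ fun i j => l1_hasse_le hdeg _
    have h5 : (k.factorial : ℝ) ≤ Real.exp (ω * L) ^ k := by
      refine (Nat.cast_le.2 (Nat.factorial_le_pow k)).trans ?_
      push_cast
      gcongr
      have := Real.add_one_le_exp (ω * L)
      linarith
    have h6 : (2 : ℝ) ^ (∑ h, r h) ≤ Real.exp (ω * L) := by
      calc (2 : ℝ) ^ (∑ h, r h) ≤ Real.exp 1 ^ (∑ h, r h) := by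
            gcongr
            have := Real.add_one_le_exp 1
            linarith
        _ = Real.exp (∑ h, (r h : ℝ)) := by rw [← Real.exp_nat_mul]; simp
        _ ≤ _ := Real.exp_le_exp.2 hsum
    calc l1 W ≤ Real.exp (ω * L) ^ k * (Real.exp (ω * L) * Real.exp (ω * L)) ^ k := by
          refine h4.trans ?_
          have := l1_nonneg P
          gcongr
      _ = Real.exp (3 * ω * (k * L)) := by
          rw [← Real.exp_add, ← Real.exp_nat_mul, ← Real.exp_nat_mul, ← Real.exp_add]
          congr 1; ring
  have hωω' : ω ≤ ω' := by linarith
  have hkL : 0 < k * L := mul_pos hk0' hL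
  -- the inductive hypothesis for the factor not involving the variable `0`
  obtain ⟨I, hI, hwI⟩ := h (fun h => k * r h.succ) (fun h => p h.succ) (fun h => q h.succ)
    (k * L) U' hU' (fun h => Nat.mul_pos hk0 (hr _)) (fun h => hq _) (fun h => hpq _) hkL
    (fun h => by
      push_cast; rw [mul_assoc]; exact mul_le_mul_of_nonneg_left (hLq _) hk0'.le)
    (by
      rw [Fin.sum_univ_succ] at hsum
      push_cast
      rw [← Finset.mul_sum]
      have := (hr' 0).le
      nlinarith [mul_le_mul_of_nonneg_right hωω' hL.le])
    (fun i j hij => by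
      have := hord i.succ j.succ (Fin.succ_lt_succ_iff.2 hij)
      push_cast
      nlinarith [mul_le_mul_of_nonneg_right hωω' (hr' j.succ).le])
    (fun h => (hUd h).trans (degreeOf_det_le fun i j => (degreeOf_hasse_le _ _ _).trans (hdeg _)))
    (hUl.trans (hWl.trans (Real.exp_le_exp.2 (mul_le_mul_of_nonneg_right h2 hkL.le))))
  obtain ⟨l, hl, hlq⟩ := Polynomial.exists_coeff_taylor_ne_zero hV' (hq 0) (hpq 0)
  have hlr : (l : ℝ) ≤ 3 * ω * k * r 0 := by
    have h4 : (q 0 : ℝ) ^ l ≤ Real.exp (3 * ω * (k * L)) := by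
      refine le_trans ?_ (hVl.trans hWl)
      exact_mod_cast hlq
    have hq0 : (0 : ℝ) < q 0 := by exact_mod_cast hq 0
    have h5 := (Real.log_le_iff_le_exp (pow_pos hq0 l)).2 h4
    rw [Real.log_pow] at h5
    have h6 : 0 < Real.log (q 0) := pos_of_mul_pos_right (hL.trans_le (hLq 0)) (hr' 0).le
    have h7 : 3 * ω * k * L ≤ 3 * ω * k * (r 0 * Real.log (q 0)) :=
      mul_le_mul_of_nonneg_left (hLq 0) (by positivity)
    refine le_of_mul_le_mul_right ?_ h6
    linarith
  rw [hUm, map_smul, coeff_smul] at hI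
  rw [hVm, map_smul, Polynomial.coeff_smul] at hl
  have hI' := right_ne_zero_of_mul hI
  have hl' := right_ne_zero_of_mul hl
  have hwt : wt r (I.cons l) ≤ k * (2 * (ε ^ 2 / 100)) := by
    have h4 : wt (fun h => k * r h.succ) I = wt (fun h => r h.succ) I / k := by
      simp only [wt, Finset.sum_div]
      refine Finset.sum_congr rfl fun h _ => ?_
      push_cast
      rw [mul_comm, div_mul_eq_div_div]
    rw [h4, div_le_iff₀ hk0'] at hwI
    have h5 : (l : ℝ) / r 0 ≤ k * (ε ^ 2 / 100) := by
      rw [div_le_iff₀ (hr' 0)]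
      refine hlr.trans ?_
      have := mul_pos hk0' (hr' 0)
      nlinarith
    rw [wt_cons]
    linarith
  by_contra! hcon
  set ξ := fun h => (p h : ℚ) / q h with hξ
  have hord1 : OrdGE r ε (translate ξ (map (Int.castRingHom ℚ) P)) := fun I hI => (hcon I hI).le
  have htW : translate ξ (map (Int.castRingHom ℚ) W) = (Matrix.of fun i j =>
      hasse ((b i).cons (c j)) (translate ξ (map (Int.castRingHom ℚ) P))).det := by
    rw [hWdef, RingHom.map_det, AlgHom.map_det]
    congr 1
    ext1 i j
    simp [hasse_translate, hasse_map]
  have hord2 : OrdGE r (∑ j : Fin k, max 0 (ε - ω - (j : ℕ) / r 0))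
      (translate ξ (map (Int.castRingHom ℚ) W)) := by
    rw [htW]
    refine OrdGE.det fun i j => ?_
    rcases le_total (ε - ω - (j : ℕ) / r 0 : ℝ) 0 with h4 | h4
    · rw [max_eq_left h4]; exact ordGE_of_nonpos le_rfl _
    rw [max_eq_right h4]
    refine (hord1.hasse _).mono ?_
    rw [wt_cons]
    have h5 : (c j : ℝ) / r 0 ≤ (j : ℕ) / r 0 :=
      div_le_div_of_nonneg_right (by exact_mod_cast hc j) (hr' 0).le
    have h6 : wt (fun h => r h.succ) (b i) ≤ ω := by
      calc wt (fun h => r h.succ) (b i) ≤ ∑ h, (b i h : ℝ) * (ω / r 0) := by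
            refine Finset.sum_le_sum fun h _ => ?_
            rw [div_eq_mul_inv]
            refine mul_le_mul_of_nonneg_left ?_ (Nat.cast_nonneg _)
            rw [inv_eq_one_div, div_le_div_iff₀ (hr' _) (hr' 0), one_mul]
            exact hord 0 h.succ (Fin.succ_pos h)
        _ = ((∑ h, b i h : ℕ) : ℝ) * (ω / r 0) := by push_cast; rw [Finset.sum_mul]
        _ ≤ r 0 * (ω / r 0) := by
            refine mul_le_mul_of_nonneg_right ?_ (by have := hr' 0; positivity)
            have := hb i
            have := i.2
            exact_mod_cast (by omega : ∑ h, b i h ≤ r 0)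
        _ = ω := mul_div_cancel₀ _ (hr' 0).ne'
    linarith
  have h7 := hord2 (I.cons l) (by
    rw [hW, translate_tensor, coeff_cons_tensor]
    exact mul_ne_zero hI' hl')
  have h8 := sq_le_sum_max_sub_div (hr 0) hk (e := ε - ω) (by linarith) (by linarith)
  have h9 : (ε / 2) ^ 2 ≤ (ε - ω) ^ 2 := by
    have : ε / 2 ≤ ε - ω := by linarith
    gcongr
  have h10 : k * (ε / 2) ^ 2 ≤ k * (ε - ω) ^ 2 := mul_le_mul_of_nonneg_left h9 hk0'.le
  have : 0 < k * ε ^ 2 := by positivity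
  nlinarith

theorem exists_rothLemma (n : ℕ) : ∀ ε : ℝ, 0 < ε → ε ≤ 1 →
    ∃ ω : ℝ, 0 < ω ∧ ω ≤ 1 ∧ RothLemma n ε ω := by
  induction n with
  | zero =>
    intro ε hε _
    refine ⟨1, one_pos, le_rfl, fun r p q L P hP _ _ _ _ _ _ _ _ _ =>
      ⟨0, ?_, by simpa [wt] using hε.le⟩⟩
    obtain ⟨I, hI⟩ := ne_zero_iff.1 hP
    rw [coeff_translate, hasse_zero, eq_C_of_isEmpty P]
    simpa [Subsingleton.elim I 0] using hI
  | succ n ih =>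
    intro ε hε hε1
    obtain ⟨ω', hω', hω1', h⟩ := ih (ε ^ 2 / 100) (by positivity) (by nlinarith)
    refine ⟨min (ε / 2) (min (ω' / 3) (ε ^ 2 / 300)), by positivity, ?_,
      h.succ hε hε1 (by positivity) (min_le_left _ _) ?_ ?_⟩
    · exact (min_le_left _ _).trans (by linarith)
    · have := (min_le_right (ε / 2) (min (ω' / 3) (ε ^ 2 / 300))).trans (min_le_left _ _)
      linarith
    · have := (min_le_right (ε / 2) (min (ω' / 3) (ε ^ 2 / 300))).trans (min_le_right _ _)
      linarith

end

section

open scoped Matrix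

section Siegel

attribute [local instance] Matrix.seminormedAddCommGroup

theorem exists_ne_zero_mulVec_eq_zero_le {ι κ : Type*} [Fintype ι] [Fintype κ]
    (A : Matrix ι κ ℤ) {M : ℝ} (hM : 1 ≤ M) (hA : ∀ i j, |(A i j : ℝ)| ≤ M)
    (hι : 0 < Fintype.card ι) (hικ : 2 * Fintype.card ι ≤ Fintype.card κ) :
    ∃ t : κ → ℤ, t ≠ 0 ∧ A *ᵥ t = 0 ∧ ∀ j, |(t j : ℝ)| ≤ Fintype.card κ * M := by
  obtain ⟨t, ht, hAt, hn⟩ := Int.Matrix.exists_ne_zero_int_vec_norm_le A (by omega) hι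
  refine ⟨t, ht, hAt, fun j => ?_⟩
  have h1 : (0 : ℝ) < Fintype.card ι := by exact_mod_cast hι
  have h2 : 2 * (Fintype.card ι : ℝ) ≤ Fintype.card κ := by exact_mod_cast hικ
  have h3 : (1 : ℝ) ≤ Fintype.card κ := by exact_mod_cast (by omega : 1 ≤ Fintype.card κ)
  have h4 : ‖A‖ ≤ M := (Matrix.norm_le_iff (by linarith)).2 fun i j => by
    rw [Int.norm_eq_abs]; exact hA i j
  have h5 : (1 : ℝ) ≤ Fintype.card κ * max 1 ‖A‖ :=
    one_le_mul_of_one_le_of_one_le h3 (le_max_left _ _)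
  calc |(t j : ℝ)| = ‖t j‖ := (Int.norm_eq_abs _).symm
    _ ≤ ‖t‖ := norm_le_pi_norm t j
    _ ≤ _ := hn
    _ ≤ (Fintype.card κ * max 1 ‖A‖) ^ (1 : ℝ) := by
        refine Real.rpow_le_rpow_of_exponent_le h5 ?_
        rw [div_le_one (by linarith)]
        linarith
    _ = Fintype.card κ * max 1 ‖A‖ := Real.rpow_one _
    _ ≤ Fintype.card κ * M := by gcongr; exact max_le hM h4

end Siegel

theorem exists_pow_eq_sum_int {R : Type*} [CommRing R] {x : R} (hx : IsIntegral ℤ x) :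
    ∃ (d : ℕ) (A : ℝ) (a : ℕ → ℕ → ℤ), 1 ≤ A ∧
      (∀ l, x ^ l = ∑ k ∈ Finset.range d, (a l k : R) * x ^ k) ∧
      ∀ l, ∀ k < d, |(a l k : ℝ)| ≤ A ^ l := by
  rcases subsingleton_or_nontrivial R with hR | hR
  · exact ⟨0, 1, 0, le_rfl, fun l => Subsingleton.elim _ _, fun l k hk => by omega⟩
  obtain ⟨f, hf, hfx⟩ := hx
  obtain ⟨e, he⟩ : ∃ e, f.natDegree = e + 1 := by
    refine ⟨f.natDegree - 1, ?_⟩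
    have : f.natDegree ≠ 0 := by
      intro h0
      rw [hf.natDegree_eq_zero.1 h0] at hfx
      simp at hfx
    omega
  have hfx' : x ^ (e + 1) = ∑ k ∈ Finset.range (e + 1), (-f.coeff k : R) * x ^ k := by
    rw [hf.as_sum, he] at hfx
    simp only [Polynomial.eval₂_add, Polynomial.eval₂_pow, Polynomial.eval₂_X,
      Polynomial.eval₂_finsetSum, Polynomial.eval₂_mul, Polynomial.eval₂_C] at hfx
    rw [eq_neg_of_add_eq_zero_left hfx, ← Finset.sum_neg_distrib]
    simp
  set S : ℝ := ∑ k ∈ Finset.range (e + 1), |(f.coeff k : ℝ)| with hS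
  have hS0 : 0 ≤ S := Finset.sum_nonneg fun _ _ => abs_nonneg _
  have hex : ∀ l, ∃ a : ℕ → ℤ, x ^ l = ∑ k ∈ Finset.range (e + 1), (a k : R) * x ^ k ∧
      ∀ k < e + 1, |(a k : ℝ)| ≤ (1 + S) ^ l := by
    intro l
    induction l with
    | zero =>
      refine ⟨fun k => if k = 0 then 1 else 0, by simp, fun k _ => ?_⟩
      dsimp only
      split_ifs <;> simp
    | succ l ih =>
      obtain ⟨a, ha, hb⟩ := ih
      refine ⟨fun k => (if k = 0 then 0 else a (k - 1)) - a e * f.coeff k, ?_, fun k hk => ?_⟩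
      · rw [pow_succ, ha, Finset.sum_range_succ, add_mul, mul_assoc, ← pow_succ, hfx',
          Finset.mul_sum]
        push_cast
        simp only [sub_mul, Finset.sum_sub_distrib]
        rw [sub_eq_add_neg, ← Finset.sum_neg_distrib]
        congr 1
        · rw [Finset.sum_range_succ', Finset.sum_mul]
          simp [mul_assoc, pow_succ]
        · refine Finset.sum_congr rfl fun k _ => by ring
      · have h1 : |((if k = 0 then 0 else a (k - 1) : ℤ) : ℝ)| ≤ (1 + S) ^ l := by
          split_ifs
          · simp; positivity
          · exact hb _ (by omega)
        have h2 : |(f.coeff k : ℝ)| ≤ S :=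
          Finset.single_le_sum (f := fun k => |(f.coeff k : ℝ)|) (fun _ _ => abs_nonneg _)
            (Finset.mem_range.2 hk)
        have h3 : |(a e : ℝ) * f.coeff k| ≤ (1 + S) ^ l * S := by
          rw [abs_mul]
          exact mul_le_mul (hb e (by omega)) h2 (abs_nonneg _) (by positivity)
        rw [Int.cast_sub, Int.cast_mul]
        refine (abs_sub _ _).trans ?_
        rw [pow_succ]
        linarith
  choose a ha hb using hex
  exact ⟨e + 1, 1 + S, a, by linarith, ha, hb⟩

theorem sum_exp_half_sub_div_le {r : ℕ} (hr : 0 < r) (t : ℝ) :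
    ∑ j : Fin (r + 1), Real.exp (t * (1 / 2 - (j : ℕ) / r)) ≤ (r + 1) * Real.exp (t ^ 2 / 8) := by
  have hr' : (r : ℝ) ≠ 0 := by positivity
  have h1 : ∑ j : Fin (r + 1), Real.exp (t * (1 / 2 - (j : ℕ) / r)) =
      ∑ j : Fin (r + 1), Real.exp (-(t * (1 / 2 - (j : ℕ) / r))) := by
    rw [← Equiv.sum_comp Fin.revPerm]
    refine Finset.sum_congr rfl fun j _ => ?_
    congr 1
    have : ((Fin.rev j : ℕ) : ℝ) = r - (j : ℕ) := by
      rw [Fin.val_rev, Nat.cast_sub (by omega)]; push_cast; ring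
    rw [Fin.revPerm_apply, this]
    field_simp
    ring
  have h2 : ∑ j : Fin (r + 1), Real.exp (t * (1 / 2 - (j : ℕ) / r)) =
      ∑ j : Fin (r + 1), Real.cosh (t * (1 / 2 - (j : ℕ) / r)) := by
    simp only [Real.cosh_eq, add_div, Finset.sum_add_distrib, ← Finset.sum_div]
    rw [← h1]; ring
  rw [h2]
  have h3 : ∀ j : Fin (r + 1), Real.cosh (t * (1 / 2 - (j : ℕ) / r)) ≤ Real.exp (t ^ 2 / 8) := by
    intro j
    refine (Real.cosh_le_exp_half_sq _).trans (Real.exp_le_exp.2 ?_)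
    have h4 : (j : ℝ) / r ≤ 1 := by
      rw [div_le_one (by positivity)]
      exact_mod_cast Nat.lt_succ_iff.1 j.2
    have h5 : (0 : ℝ) ≤ (j : ℝ) / r := by positivity
    have h6 : (1 / 2 - (j : ℝ) / r) ^ 2 ≤ 1 / 4 := by nlinarith
    rw [mul_pow]
    nlinarith [mul_le_mul_of_nonneg_left h6 (sq_nonneg t)]
  refine (Finset.sum_le_sum fun j _ => h3 j).trans ?_
  simp

theorem card_filter_sum_div_lt_le {m : ℕ} {r : Fin m → ℕ} (hr : ∀ h, 0 < r h) {ε : ℝ} (hε : 0 ≤ ε) :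
    ((Finset.univ.filter fun I : ∀ h, Fin (r h + 1) =>
        ∑ h, ((I h : ℕ) : ℝ) / r h < m * (1 / 2 - ε)).card : ℝ) ≤
      Real.exp (-(2 * m * ε ^ 2)) * Fintype.card (∀ h, Fin (r h + 1)) := by
  classical
  have h1 : ∀ I ∈ Finset.univ.filter fun I : ∀ h, Fin (r h + 1) =>
      ∑ h, ((I h : ℕ) : ℝ) / r h < m * (1 / 2 - ε),
      (1 : ℝ) ≤ Real.exp (-(4 * ε * (m * ε))) *
        ∏ h, Real.exp (4 * ε * (1 / 2 - ((I h : ℕ) : ℝ) / r h)) := by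
    intro I hI
    rw [← Real.exp_sum, ← Real.exp_add, ← Finset.mul_sum, Finset.sum_sub_distrib]
    apply Real.one_le_exp
    have := (Finset.mem_filter.1 hI).2
    simp only [Finset.sum_const, Finset.card_univ, Fintype.card_fin, nsmul_eq_mul]
    nlinarith
  calc _ = ∑ I ∈ Finset.univ.filter fun I : ∀ h, Fin (r h + 1) =>
      ∑ h, ((I h : ℕ) : ℝ) / r h < m * (1 / 2 - ε), (1 : ℝ) := by simp
    _ ≤ ∑ I : ∀ h, Fin (r h + 1), Real.exp (-(4 * ε * (m * ε))) *
        ∏ h, Real.exp (4 * ε * (1 / 2 - ((I h : ℕ) : ℝ) / r h)) := by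
        refine (Finset.sum_le_sum h1).trans
          (Finset.sum_le_sum_of_subset_of_nonneg (Finset.subset_univ _) fun _ _ _ => by positivity)
    _ = Real.exp (-(4 * ε * (m * ε))) *
        ∏ h, ∑ j : Fin (r h + 1), Real.exp (4 * ε * (1 / 2 - (j : ℕ) / r h)) := by
        rw [← Finset.mul_sum, Finset.prod_univ_sum, Fintype.piFinset_univ]
    _ ≤ Real.exp (-(4 * ε * (m * ε))) * ∏ h : Fin m, ((r h + 1) * Real.exp ((4 * ε) ^ 2 / 8)) := by
        gcongr with h
        exact sum_exp_half_sub_div_le (hr h) _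
    _ = _ := by
        rw [Finset.prod_mul_distrib, Finset.prod_const, ← Real.exp_nat_mul, mul_comm (∏ h, _),
          ← mul_assoc, ← Real.exp_add, Fintype.card_pi]
        simp only [Fintype.card_fin, Finset.card_univ]
        push_cast
        congr 2
        ring

namespace MvPolynomial

theorem hasse_monomial {σ R : Type*} [Fintype σ] [CommRing R] (I J : σ →₀ ℕ) (c : R) :
    hasse I (monomial J c) = monomial (J - I) (((∏ h, (J h).choose (I h) : ℕ) : R) * c) := by
  have h1 : (monomial J c : MvPolynomial σ R) = c • basisMonomials σ R J := by
    simp [coe_basisMonomials, smul_monomial]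
  rw [h1, map_smul, hasse, Module.Basis.constr_basis, smul_monomial, smul_eq_mul, mul_comm]

theorem exists_small_ordGE {α : ℝ} (hα : IsIntegral ℤ α) {ε : ℝ} (hε : 0 < ε)
    (hε2 : ε < 1 / 2) :
    ∃ (m : ℕ) (B : ℝ), 0 < m ∧ 1 ≤ B ∧ ∀ r : Fin m → ℕ, (∀ h, 0 < r h) →
      ∃ P : MvPolynomial (Fin m) ℤ, P ≠ 0 ∧ (∀ h, degreeOf h P ≤ r h) ∧ l1 P ≤ B ^ (∑ h, r h) ∧
        OrdGE r (m * (1 / 2 - ε)) (translate (fun _ => α) (map (Int.castRingHom ℝ) P)) := by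
  classical
  obtain ⟨d, A, a, hA, ha, hb⟩ := exists_pow_eq_sum_int hα
  have hd : 0 < d := by
    rcases Nat.eq_zero_or_pos d with rfl | h
    · simpa using ha 0
    · exact h
  obtain ⟨m, hm⟩ := exists_nat_ge (Real.log (2 * d) / (2 * ε ^ 2))
  set m' := m + 1 with hm'
  have hmd : 2 * (d : ℝ) * Real.exp (-(2 * m' * ε ^ 2)) ≤ 1 := by
    rw [div_le_iff₀ (by positivity)] at hm
    have h1 : Real.log (2 * d) ≤ 2 * m' * ε ^ 2 := by
      rw [hm']; push_cast; nlinarith [sq_nonneg ε]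
    have h2 := (Real.log_le_iff_le_exp (by positivity)).1 h1
    rw [Real.exp_neg, ← div_eq_mul_inv]
    exact (div_le_one (Real.exp_pos _)).2 h2
  refine ⟨m', 8 * A, Nat.succ_pos _, by linarith, fun r hr => ?_⟩
  let Box := ∀ h, Fin (r h + 1)
  let toF : Box → (Fin m' →₀ ℕ) := fun J => Finsupp.equivFunOnFinite.symm fun h => (J h : ℕ)
  have htoF : ∀ (J : Box) h, toF J h = J h := fun J h => rfl
  have htoF_inj : Function.Injective toF := by
    intro J J' h
    funext i
    exact Fin.ext (DFunLike.congr_fun h i)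
  let Low := {I : Box // ∑ h, ((I h : ℕ) : ℝ) / r h < m' * (1 / 2 - ε)}
  let M : Matrix (Low × Fin d) Box ℤ := Matrix.of fun i J =>
    (∏ h, (J h : ℕ).choose (i.1.1 h) : ℕ) * a (∑ h, ((J h : ℕ) - (i.1.1 h : ℕ))) i.2
  have hcardLow : (Fintype.card Low : ℝ) ≤ Real.exp (-(2 * m' * ε ^ 2)) * Fintype.card Box := by
    have := card_filter_sum_div_lt_le hr hε.le
    rwa [← Fintype.card_subtype] at this
  have hcard : 2 * Fintype.card (Low × Fin d) ≤ Fintype.card Box := by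
    rw [Fintype.card_prod, Fintype.card_fin]
    have h1 : 2 * ((Fintype.card Low : ℝ) * d) ≤ Fintype.card Box := by
      have h2 : (0 : ℝ) ≤ Fintype.card Box := Nat.cast_nonneg _
      have h3 := mul_le_mul_of_nonneg_right hmd h2
      have h4 := mul_le_mul_of_nonneg_left hcardLow (by positivity : (0 : ℝ) ≤ 2 * d)
      linarith
    exact_mod_cast h1
  have hcardpos : 0 < Fintype.card (Low × Fin d) := by
    have : Nonempty Low := ⟨⟨fun _ => 0, by
      simp only [Fin.val_zero, Nat.cast_zero, zero_div, Finset.sum_const_zero]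
      have : (0 : ℝ) < m' := by exact_mod_cast Nat.succ_pos m
      exact mul_pos this (by linarith)⟩⟩
    have : Nonempty (Fin d) := ⟨⟨0, hd⟩⟩
    exact Fintype.card_pos
  have hM : ∀ i J, |(M i J : ℝ)| ≤ (2 * A) ^ (∑ h, r h) := by
    intro i J
    have h1 := prod_choose_le (r := r) (J := toF J) (I := toF i.1.1)
      fun h => Nat.lt_succ_iff.1 (J h).2
    have h2 : |(a (∑ h, ((J h : ℕ) - (i.1.1 h : ℕ))) i.2 : ℝ)| ≤ A ^ (∑ h, r h) := by
      refine (hb _ _ i.2.2).trans (pow_le_pow_right₀ hA (Finset.sum_le_sum fun h _ => ?_))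
      have := (J h).2
      omega
    have h3 : (M i J : ℝ) = ((∏ h, (toF J h).choose (toF i.1.1 h) : ℕ) : ℝ) *
        (a (∑ h, ((J h : ℕ) - (i.1.1 h : ℕ))) i.2 : ℝ) := by
      simp only [M, Matrix.of_apply, htoF]
      push_cast
      rfl
    rw [h3, abs_mul, Nat.abs_cast, mul_pow]
    exact mul_le_mul h1 h2 (abs_nonneg _) (by positivity)
  obtain ⟨t, ht, hMt, htb⟩ := exists_ne_zero_mulVec_eq_zero_le M
    (one_le_pow₀ (by linarith)) hM hcardpos hcard
  set P : MvPolynomial (Fin m') ℤ := ∑ J, monomial (toF J) (t J) with hP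
  have hPc : ∀ J, coeff (toF J) P = t J := by
    intro J
    rw [hP, coeff_sum, Finset.sum_eq_single J]
    · simp
    · intro J' _ hJ'
      rw [coeff_monomial, if_neg fun h => hJ' (htoF_inj h)]
    · simp
  have hBox : (Fintype.card Box : ℝ) ≤ 2 ^ (∑ h, r h) := by
    rw [Fintype.card_pi, ← Finset.prod_pow_eq_pow_sum]
    push_cast
    refine Finset.prod_le_prod (fun _ _ => by positivity) fun h _ => ?_
    rw [Fintype.card_fin]
    exact_mod_cast Nat.lt_two_pow_self
  refine ⟨P, ?_, fun h => ?_, ?_, ?_⟩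
  · intro h0
    refine ht ?_
    ext J
    rw [← hPc, h0, coeff_zero, Pi.zero_apply]
  · refine (degreeOf_sum_le _ _ _).trans (Finset.sup_le fun J _ => degreeOf_le_iff.2 fun K hK => ?_)
    rw [Finset.mem_singleton.1 (support_monomial_subset hK), htoF]
    exact Nat.lt_succ_iff.1 (J h).2
  · calc l1 P ≤ ∑ J, l1 (monomial (toF J) (t J)) := l1_sum_le _ _
      _ ≤ ∑ J : Box, (Fintype.card Box : ℝ) * (2 * A) ^ (∑ h, r h) := by
          refine Finset.sum_le_sum fun J _ => ?_
          rw [l1_monomial, Int.norm_eq_abs]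
          exact htb J
      _ = Fintype.card Box * (Fintype.card Box * (2 * A) ^ (∑ h, r h)) := by simp
      _ ≤ 2 ^ (∑ h, r h) * (2 ^ (∑ h, r h) * (2 * A) ^ (∑ h, r h)) := by gcongr
      _ = (8 * A) ^ (∑ h, r h) := by rw [← mul_pow, ← mul_pow]; congr 1; ring
  · intro I hI
    by_contra! hlt
    refine hI ?_
    have hev : ∀ J : Box, eval (fun _ => α) (hasse I (monomial (toF J) (t J : ℝ))) =
        (∏ h, (J h : ℕ).choose (I h) : ℕ) * t J * α ^ (∑ h, ((J h : ℕ) - I h)) := by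
      intro J
      rw [hasse_monomial, eval_monomial, Finsupp.prod_fintype _ _ (fun _ => pow_zero _),
        Finset.prod_pow_eq_pow_sum]
      rfl
    have hev' : coeff I (translate (fun _ => α) (map (Int.castRingHom ℝ) P)) =
        ∑ J : Box, (∏ h, (J h : ℕ).choose (I h) : ℕ) * t J * α ^ (∑ h, ((J h : ℕ) - I h)) := by
      rw [coeff_translate, hP, map_sum, map_sum, map_sum]
      refine Finset.sum_congr rfl fun J _ => ?_
      rw [map_monomial]
      exact hev J
    rw [hev']
    by_cases hIr : ∀ h, I h ≤ r h
    · let I' : Low := ⟨fun h => ⟨I h, Nat.lt_succ_iff.2 (hIr h)⟩, hlt⟩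
      calc ∑ J : Box, ((∏ h, (J h : ℕ).choose (I h) : ℕ) : ℝ) * t J * α ^ (∑ h, ((J h : ℕ) - I h))
          = ∑ J : Box, ∑ k : Fin d, ((M (I', k) J * t J : ℤ) : ℝ) * α ^ (k : ℕ) := by
            refine Finset.sum_congr rfl fun J _ => ?_
            rw [ha, Finset.sum_range, Finset.mul_sum]
            refine Finset.sum_congr rfl fun k _ => ?_
            simp only [M, Matrix.of_apply, I']
            push_cast
            ring
        _ = ∑ k : Fin d, (((M *ᵥ t) (I', k) : ℤ) : ℝ) * α ^ (k : ℕ) := by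
            rw [Finset.sum_comm]
            refine Finset.sum_congr rfl fun k _ => ?_
            rw [Matrix.mulVec, dotProduct, Int.cast_sum, Finset.sum_mul]
        _ = 0 := by simp [hMt]
    · push Not at hIr
      obtain ⟨h, hh⟩ := hIr
      refine Finset.sum_eq_zero fun J _ => ?_
      have : (J h : ℕ).choose (I h) = 0 := Nat.choose_eq_zero_of_lt (by have := (J h).2; omega)
      rw [Finset.prod_eq_zero (Finset.mem_univ h) this]
      simp

end MvPolynomial

end

namespace MvPolynomial

theorem translate_add_eval {σ R : Type*} [Fintype σ] [CommRing R] (ξ β : σ → R)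
    (P : MvPolynomial σ R) : eval β (translate ξ P) = eval (β + ξ) P := by
  induction P using MvPolynomial.induction_on with
  | C a => simp [translate]
  | add p q hp hq => simp only [map_add, hp, hq]
  | mul_X p i hp => simp only [map_mul, hp]; simp [translate]

theorem l1_translate_le {σ : Type*} [Fintype σ] {A : ℝ} (hA : 0 ≤ A) {ξ : σ → ℝ}
    (hξ : ∀ h, |ξ h| ≤ A)
    {r : σ → ℕ} {P : MvPolynomial σ ℝ} (hP : ∀ h, degreeOf h P ≤ r h) :
    l1 (translate ξ P) ≤ (1 + A) ^ (∑ h, r h) * l1 P := by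
  classical
  conv_lhs => rw [P.as_sum]
  rw [map_sum]
  refine (l1_sum_le _ _).trans ?_
  rw [l1, Finset.mul_sum]
  refine Finset.sum_le_sum fun J hJ => ?_
  have h1 : translate ξ (monomial J (coeff J P)) =
      C (coeff J P) * ∏ h, (X h + C (ξ h)) ^ J h := by
    rw [translate, aeval_monomial, Finsupp.prod_fintype _ _ fun _ => pow_zero _]
    rfl
  rw [h1]
  refine (l1_mul_le _ _).trans ?_
  rw [l1_C, mul_comm]
  refine mul_le_mul_of_nonneg_right ?_ (norm_nonneg _)
  refine (l1_prod_le _ _).trans ?_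
  rw [← Finset.prod_pow_eq_pow_sum]
  refine Finset.prod_le_prod (fun _ _ => l1_nonneg _) fun h _ => ?_
  have h2 : l1 (X h + C (ξ h) : MvPolynomial σ ℝ) ≤ 1 + A := by
    refine (l1_add_le _ _).trans ?_
    rw [X, l1_monomial, l1_C, norm_one, Real.norm_eq_abs]
    exact add_le_add le_rfl (hξ h)
  calc l1 ((X h + C (ξ h) : MvPolynomial σ ℝ) ^ J h) ≤ (1 + A) ^ J h :=
        (l1_pow_le _ _).trans (pow_le_pow_left₀ (l1_nonneg _) h2 _)
    _ ≤ (1 + A) ^ r h := pow_le_pow_right₀ (by linarith) (degreeOf_le_iff.1 (hP h) J hJ)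

theorem inv_prod_pow_le_abs_eval {σ : Type*} [Fintype σ] {r : σ → ℕ} {P : MvPolynomial σ ℤ}
    (hP : ∀ h, degreeOf h P ≤ r h) {p : σ → ℤ} {q : σ → ℕ} (hq : ∀ h, 0 < q h)
    (hne : eval (fun h => (p h : ℝ) / q h) (map (Int.castRingHom ℝ) P) ≠ 0) :
    (∏ h, (q h : ℝ) ^ r h)⁻¹ ≤ |eval (fun h => (p h : ℝ) / q h) (map (Int.castRingHom ℝ) P)| := by
  have hq' : ∀ h, (0 : ℝ) < q h := fun h => by exact_mod_cast hq h
  have hpos : 0 < ∏ h, (q h : ℝ) ^ r h := Finset.prod_pos fun h _ => pow_pos (hq' h) _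
  obtain ⟨z, hz⟩ : ∃ z : ℤ, (∏ h, (q h : ℝ) ^ r h) *
      eval (fun h => (p h : ℝ) / q h) (map (Int.castRingHom ℝ) P) = z := by
    refine ⟨∑ J ∈ P.support, coeff J P * ∏ h, (p h ^ J h * (q h : ℤ) ^ (r h - J h)), ?_⟩
    rw [eval_map, eval₂_eq', Finset.mul_sum]
    push_cast
    refine Finset.sum_congr rfl fun J hJ => ?_
    rw [eq_intCast, mul_left_comm, ← Finset.prod_mul_distrib]
    congr 1
    refine Finset.prod_congr rfl fun h _ => ?_
    have h1 : J h ≤ r h := degreeOf_le_iff.1 (hP h) J hJ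
    rw [div_pow, ← Nat.sub_add_cancel h1, pow_add, Nat.add_sub_cancel]
    have := (hq' h).ne'
    field_simp
  rw [inv_le_iff_one_le_mul₀ hpos, mul_comm, ← abs_of_pos hpos, ← abs_mul, hz]
  have : z ≠ 0 := by
    rintro rfl
    rw [Int.cast_zero] at hz
    exact (mul_ne_zero hpos.ne' hne) hz
  exact_mod_cast Int.one_le_abs this

theorem OrdGE.abs_eval_le {σ : Type*} [Fintype σ] {r : σ → ℕ} {τ M : ℝ} {P : MvPolynomial σ ℝ}
    (hP : OrdGE r τ P) (hM : 0 ≤ M) {β : σ → ℝ}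
    (hβ : ∀ h, |β h| ≤ Real.exp (-(M / r h))) :
    |eval β P| ≤ l1 P * Real.exp (-(M * τ)) := by
  rw [eval_eq', l1, Finset.sum_mul]
  refine (Finset.abs_sum_le_sum_abs _ _).trans (Finset.sum_le_sum fun J hJ => ?_)
  rw [abs_mul]
  refine mul_le_mul_of_nonneg_left ?_ (abs_nonneg _)
  have h1 := hP J (mem_support_iff.1 hJ)
  calc |∏ h, β h ^ J h| = ∏ h, |β h| ^ J h := by rw [Finset.abs_prod]; simp only [abs_pow]
    _ ≤ ∏ h, Real.exp (-(M / r h)) ^ J h :=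
        Finset.prod_le_prod (fun _ _ => by positivity) fun h _ =>
          pow_le_pow_left₀ (abs_nonneg _) (hβ h) _
    _ = Real.exp (-(M * wt r J)) := by
        simp only [← Real.exp_nat_mul]
        rw [← Real.exp_sum, wt, Finset.mul_sum, ← Finset.sum_neg_distrib]
        congr 1
        refine Finset.sum_congr rfl fun h _ => by ring
    _ ≤ Real.exp (-(M * τ)) := by
        apply Real.exp_le_exp.2
        nlinarith

end MvPolynomial

section

open MvPolynomial

theorem exists_log_growing_seq {S : ℤ → ℕ → Prop} (hS : ∀ x : ℝ, ∃ p q, S p q ∧ x ≤ Real.log q)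
    {ℓ A : ℝ} (hℓ : 0 ≤ ℓ) (hA : 1 ≤ A) :
    ∃ (p : ℕ → ℤ) (q : ℕ → ℕ), (∀ n, S (p n) (q n)) ∧ (∀ n, ℓ ≤ Real.log (q n)) ∧
      ∀ i j, i < j → A * Real.log (q i) ≤ Real.log (q j) := by
  choose P Q hPQ hQ using hS
  let x : ℕ → ℝ := fun n => Nat.rec ℓ (fun _ y => A * Real.log (Q y)) n
  have hstep : ∀ n, A * Real.log (Q (x n)) ≤ Real.log (Q (x (n + 1))) := fun n => hQ _
  have hℓ' : ∀ n, ℓ ≤ Real.log (Q (x n)) := by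
    intro n
    induction n with
    | zero => exact hQ _
    | succ n ih => exact le_trans (by nlinarith) (hstep n)
  refine ⟨fun n => P (x n), fun n => Q (x n), fun n => hPQ _, hℓ', fun i j hij => ?_⟩
  induction j, hij using Nat.le_induction with
  | base => exact hstep i
  | succ j _ ih =>
    refine ih.trans (le_trans ?_ (hstep j))
    nlinarith [hℓ' j]

set_option maxHeartbeats 1000000 in
theorem exists_bound_of_isIntegral {α : ℝ} (hα : IsIntegral ℤ α) {δ : ℝ} (hδ : 0 < δ)
    (hδ1 : δ ≤ 1) :
    ∃ X : ℝ, ∀ (p : ℤ) (q : ℕ), 0 < q → IsCoprime p (q : ℤ) →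
      |α - p / q| ≤ Real.exp (-((2 + δ) * Real.log q)) → Real.log q ≤ X := by
  by_contra! hcon
  set ε := δ / 32 with hε
  have hε0 : 0 < ε := by positivity
  have hε1 : ε ≤ 1 / 32 := by rw [hε]; linarith
  obtain ⟨m, B, hm, hB, hP⟩ := exists_small_ordGE hα hε0 (by linarith)
  obtain ⟨ω, hω, hω1, hroth⟩ := exists_rothLemma m ε hε0 (by linarith)
  have hm1 : (1 : ℝ) ≤ m := by exact_mod_cast hm
  set B' := (1 + |α|) * (2 * B) with hB'
  have hBB' : B ≤ B' := by
    rw [hB']; nlinarith [mul_nonneg (abs_nonneg α) (by linarith : (0 : ℝ) ≤ B)]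
  have hB'0 : 0 < B' := by linarith
  set K := Real.log B' with hK
  have hK0 : 0 ≤ K := Real.log_nonneg (by linarith)
  set ℓ := 2 * m * (1 + K) / (ω * ε) with hℓ
  have hℓ0 : 0 < ℓ := by positivity
  obtain ⟨p', q', hS, hq'ℓ, hq'⟩ := exists_log_growing_seq (S := fun p q => 0 < q ∧
    IsCoprime p (q : ℤ) ∧ |α - p / q| ≤ Real.exp (-((2 + δ) * Real.log q)))
    (fun x => by
      obtain ⟨p, q, h1, h2, h3, h4⟩ := hcon x
      exact ⟨p, q, ⟨h1, h2, h3⟩, h4.le⟩) hℓ0.le (A := 2 / ω) (by rw [le_div_iff₀ hω]; linarith)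
  let p : Fin m → ℤ := fun h => p' (Fin.rev h)
  let q : Fin m → ℕ := fun h => q' (Fin.rev h)
  have hq0 : ∀ h, 0 < q h := fun h => (hS _).1
  have hpq : ∀ h, IsCoprime (p h) (q h : ℤ) := fun h => (hS _).2.1
  have happ : ∀ h, |α - p h / q h| ≤ Real.exp (-((2 + δ) * Real.log (q h))) := fun h => (hS _).2.2
  have hlogℓ : ∀ h, ℓ ≤ Real.log (q h) := fun h => hq'ℓ _
  have hlog0 : ∀ h, 0 < Real.log (q h) := fun h => hℓ0.trans_le (hlogℓ h)
  have hgrow : ∀ i j, i < j → 2 * Real.log (q j) ≤ ω * Real.log (q i) := by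
    intro i j hij
    have := hq' _ _ (Fin.lt_def.1 (Fin.rev_lt_rev.2 hij))
    rw [div_mul_eq_mul_div, div_le_iff₀ hω] at this
    simpa only [mul_comm ω] using this
  set L := (∑ h, Real.log (q h)) / ε with hL
  have hlogL : ∀ h, Real.log (q h) ≤ ε * L := by
    intro h
    rw [hL, mul_div_cancel₀ _ hε0.ne']
    exact Finset.single_le_sum (f := fun h => Real.log (q h)) (fun h _ => (hlog0 h).le)
      (Finset.mem_univ h)
  have hL0 : 0 < L := by
    have := (hlog0 ⟨0, hm⟩).trans_le (hlogL ⟨0, hm⟩)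
    exact pos_of_mul_pos_right this hε0.le
  let r : Fin m → ℕ := fun h => ⌈L / Real.log (q h)⌉₊
  have hr0 : ∀ h, 0 < r h := fun h => Nat.ceil_pos.2 (div_pos hL0 (hlog0 h))
  have hr1 : ∀ h, L ≤ r h * Real.log (q h) := fun h =>
    (div_le_iff₀ (hlog0 h)).1 (Nat.le_ceil _)
  have hr2 : ∀ h, r h * Real.log (q h) ≤ (1 + ε) * L := by
    intro h
    have h1 : (r h : ℝ) < L / Real.log (q h) + 1 := Nat.ceil_lt_add_one (div_pos hL0 (hlog0 h)).le
    have h2 := mul_lt_mul_of_pos_right h1 (hlog0 h)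
    rw [add_mul, div_mul_cancel₀ _ (hlog0 h).ne'] at h2
    have := hlogL h
    linarith
  have hrsum : (∑ h, (r h : ℝ)) * (1 + K) ≤ ω * ε * L := by
    have h1 : ∀ h, (r h : ℝ) * ℓ ≤ 2 * L := fun h => by
      have := mul_le_mul_of_nonneg_left (hlogℓ h) (Nat.cast_nonneg (α := ℝ) (r h))
      have := hr2 h
      nlinarith
    have h2 : (∑ h, (r h : ℝ)) * ℓ ≤ m * (2 * L) := by
      rw [Finset.sum_mul]
      refine (Finset.sum_le_sum fun h _ => h1 h).trans ?_
      simp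
    rw [hℓ, ← mul_div_assoc, div_le_iff₀ (by positivity)] at h2
    have h3 : (0 : ℝ) < 2 * m := by linarith
    refine le_of_mul_le_mul_left ?_ h3
    linarith
  have hrs0 : 0 ≤ ∑ h, (r h : ℝ) := Finset.sum_nonneg fun _ _ => Nat.cast_nonneg _
  have hωL : 0 < ω * L := mul_pos hω hL0
  have hrK : (∑ h, (r h : ℝ)) * K ≤ ε * L := by nlinarith [mul_pos hε0 hL0]
  have hpowK : ∀ C : ℝ, 0 < C → C ^ (∑ h, r h) = Real.exp ((∑ h, (r h : ℝ)) * Real.log C) := by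
    intro C hC
    rw [mul_comm, ← Real.rpow_def_of_pos hC, ← Nat.cast_sum, Real.rpow_natCast]
  obtain ⟨P, hP0, hPdeg, hPl, hPord⟩ := hP r hr0
  obtain ⟨J, hJ, hJw⟩ := hroth r p q L P hP0 hr0 hq0 hpq hL0 hr1
    (by nlinarith [mul_nonneg hrs0 hK0])
    (fun i j hij => by
      have h1 : (r i : ℝ) * Real.log (q i) ≤ 2 * L := (hr2 i).trans (by nlinarith)
      have h2 := mul_le_mul_of_nonneg_left (hgrow i j hij) (Nat.cast_nonneg (α := ℝ) (r j))
      have h3 := hr1 j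
      refine le_of_mul_le_mul_right ?_ (hlog0 i)
      linarith) hPdeg (by
      refine hPl.trans ?_
      rw [hpowK B (by linarith)]
      refine Real.exp_le_exp.2 ?_
      have h1 : Real.log B ≤ K := Real.log_le_log (by linarith) hBB'
      have h2 := mul_le_mul_of_nonneg_left h1 hrs0
      nlinarith)
  have hne : eval (fun h => (p h : ℝ) / q h) (map (Int.castRingHom ℝ) (hasse J P)) ≠ 0 := by
    rw [coeff_translate, hasse_map, eval_map, eval₂_eq'] at hJ
    rw [eval_map, eval₂_eq']
    simp only [eq_intCast] at hJ ⊢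
    exact_mod_cast hJ
  have hlow := inv_prod_pow_le_abs_eval (fun h => (degreeOf_hasse_le h J P).trans (hPdeg h)) hq0 hne
  set G := translate (fun _ => α) (map (Int.castRingHom ℝ) (hasse J P)) with hG
  have hGl : l1 G ≤ Real.exp (ε * L) := by
    calc l1 G ≤ (1 + |α|) ^ (∑ h, r h) * l1 (map (Int.castRingHom ℝ) (hasse J P)) :=
          l1_translate_le (abs_nonneg _) (fun _ => le_rfl) fun h => degreeOf_le_iff.2 fun K hK =>
            degreeOf_le_iff.1 ((degreeOf_hasse_le h J P).trans (hPdeg h)) K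
              (support_map_subset _ _ hK)
      _ = (1 + |α|) ^ (∑ h, r h) * l1 (hasse J P) := by
          rw [l1_map _ fun a => by rw [eq_intCast, Int.norm_cast_real]]
      _ ≤ (1 + |α|) ^ (∑ h, r h) * (2 ^ (∑ h, r h) * B ^ (∑ h, r h)) := by
          gcongr
          refine (l1_hasse_le hPdeg J).trans ?_
          gcongr
      _ = B' ^ (∑ h, r h) := by rw [← mul_pow, ← mul_pow]
      _ ≤ Real.exp (ε * L) := by
          rw [hpowK B' hB'0]
          exact Real.exp_le_exp.2 hrK
  have hGord : OrdGE r (m * (1 / 2 - ε) - wt r J) G := by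
    rw [hG, ← hasse_map, ← hasse_translate]
    exact hPord.hasse J
  have hup := hGord.abs_eval_le (M := (2 + δ) * L) (by positivity)
    (β := fun h => (p h : ℝ) / q h - α) (fun h => by
      rw [abs_sub_comm]
      refine (happ h).trans (Real.exp_le_exp.2 (neg_le_neg ?_))
      have : (0 : ℝ) < r h := by exact_mod_cast hr0 h
      rw [div_le_iff₀ this, mul_assoc]
      have := hr1 h
      gcongr
      linarith)
  have hev : eval (fun h => (p h : ℝ) / q h - α) G =
      eval (fun h => (p h : ℝ) / q h) (map (Int.castRingHom ℝ) (hasse J P)) := by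
    rw [hG, translate_add_eval]
    congr 2
    funext h
    simp
  rw [hev] at hup
  have hlow' : Real.exp (-(m * ((1 + ε) * L))) ≤ (∏ h, (q h : ℝ) ^ r h)⁻¹ := by
    rw [Real.exp_neg]
    refine inv_anti₀ (Finset.prod_pos fun h _ => pow_pos (by exact_mod_cast hq0 h) _) ?_
    calc ∏ h, (q h : ℝ) ^ r h = Real.exp (∑ h, r h * Real.log (q h)) := by
          rw [Real.exp_sum]
          refine Finset.prod_congr rfl fun h _ => ?_
          rw [Real.exp_nat_mul, Real.exp_log (by exact_mod_cast hq0 h)]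
      _ ≤ Real.exp (m * ((1 + ε) * L)) := by
          refine Real.exp_le_exp.2 ((Finset.sum_le_sum fun h _ => hr2 h).trans ?_)
          simp
  have hfin := (hlow'.trans hlow).trans (hup.trans
    (mul_le_mul_of_nonneg_right hGl (Real.exp_pos _).le))
  rw [← Real.exp_add, Real.exp_le_exp] at hfin
  have hδε : δ = 32 * ε := by rw [hε]; ring
  have h1 : (2 + δ) * L * (m * (1 / 2 - ε) - m * ε) ≤
      (2 + δ) * L * (m * (1 / 2 - ε) - wt r J) := by
    refine mul_le_mul_of_nonneg_left ?_ (by positivity)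
    nlinarith
  have h2 : L * (m * ((2 + δ) * (1 / 2 - 2 * ε))) ≤ L * (m * (1 + 2 * ε)) := by
    have : ε * L ≤ m * (ε * L) := by nlinarith [mul_pos hε0 hL0]
    nlinarith
  have h3 := le_of_mul_le_mul_left (le_of_mul_le_mul_left h2 hL0) (by linarith : (0 : ℝ) < m)
  rw [hδε] at h3
  nlinarith

end

theorem exists_le_abs_mul_sub_of_isIntegral {α : ℝ} (hα : IsIntegral ℤ α) (hirr : Irrational α)
    {δ : ℝ} (hδ : 0 < δ) (hδ1 : δ ≤ 1) :
    ∃ C : ℝ, 0 < C ∧ ∀ (q : ℕ) (p : ℤ), 0 < q → C * (q : ℝ) ^ (-(1 + δ)) ≤ |q * α - p| := by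
  obtain ⟨X, hX⟩ := exists_bound_of_isIntegral hα hδ hδ1
  obtain ⟨c, hc, hcN⟩ : ∃ c : ℝ, 0 < c ∧ ∀ q ∈ Finset.Icc 1 ⌊Real.exp X⌋₊,
      0 < q → ∀ p : ℤ, c ≤ |(q : ℝ) * α - p| := by
    induction Finset.Icc 1 ⌊Real.exp X⌋₊ using Finset.induction_on with
    | empty => exact ⟨1, one_pos, by simp⟩
    | insert q s _ ih =>
      obtain ⟨c, hc, hs⟩ := ih
      rcases Nat.eq_zero_or_pos q with rfl | hq
      · refine ⟨c, hc, fun q' hq' hq0 => ?_⟩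
        rcases Finset.mem_insert.1 hq' with rfl | hq'
        · exact absurd hq0 (lt_irrefl 0)
        · exact hs q' hq' hq0
      have h1 : 0 < |(q : ℝ) * α - round (q * α)| :=
        abs_pos.2 (sub_ne_zero.2 ((hirr.natCast_mul hq.ne').ne_int _))
      refine ⟨min c |(q : ℝ) * α - round (q * α)|, lt_min hc h1, fun q' hq' hq0 p => ?_⟩
      rcases Finset.mem_insert.1 hq' with rfl | hq'
      · exact (min_le_right _ _).trans (round_le _ _)
      · exact (min_le_left _ _).trans (hs q' hq' hq0 p)
  refine ⟨min c 1, lt_min hc one_pos, ?_⟩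
  have hexp : ∀ q : ℕ, 0 < q → (q : ℝ) ^ (-(1 + δ)) = Real.exp (-((1 + δ) * Real.log q)) := by
    intro q hq
    rw [Real.rpow_def_of_pos (by exact_mod_cast hq)]
    congr 1; ring
  have hcop : ∀ (q : ℕ) (p : ℤ), 0 < q → IsCoprime p (q : ℤ) →
      min c 1 * (q : ℝ) ^ (-(1 + δ)) ≤ |q * α - p| := by
    intro q p hq hpq
    have hq' : (0 : ℝ) < q := by exact_mod_cast hq
    by_cases hqX : Real.log q ≤ X
    · have h1 : q ∈ Finset.Icc 1 ⌊Real.exp X⌋₊ :=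
        Finset.mem_Icc.2 ⟨hq, Nat.le_floor ((Real.log_le_iff_le_exp hq').1 hqX)⟩
      refine le_trans ?_ (hcN q h1 hq p)
      have h2 : (q : ℝ) ^ (-(1 + δ)) ≤ 1 :=
        Real.rpow_le_one_of_one_le_of_nonpos (by exact_mod_cast hq) (by linarith)
      have h3 : 0 ≤ (q : ℝ) ^ (-(1 + δ)) := by positivity
      calc min c 1 * (q : ℝ) ^ (-(1 + δ)) ≤ c * 1 := by
            gcongr
            exact min_le_left _ _
        _ = c := mul_one c
    · have h1 : Real.exp (-((2 + δ) * Real.log q)) < |α - p / q| := by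
        by_contra! hcon
        exact hqX (hX p q hq hpq hcon)
      have h2 : |q * α - p| = q * |α - p / q| := by
        rw [← abs_of_pos hq', ← abs_mul, abs_of_pos hq', mul_sub, mul_div_cancel₀ _ hq'.ne']
      have h3 : (q : ℝ) ^ (-(1 + δ)) = q * Real.exp (-((2 + δ) * Real.log q)) := by
        rw [hexp q hq]
        nth_rw 2 [← Real.exp_log hq']
        rw [← Real.exp_add]
        congr 1; ring
      rw [h2, h3]
      calc min c 1 * (q * Real.exp (-((2 + δ) * Real.log q))) ≤
            1 * (q * Real.exp (-((2 + δ) * Real.log q))) := by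
            gcongr
            exact min_le_right _ _
        _ ≤ q * |α - p / q| := by rw [one_mul]; gcongr
  intro q p hq
  have hg : 0 < Int.gcd p q := Int.gcd_pos_of_ne_zero_right _ (by exact_mod_cast hq.ne')
  obtain ⟨p', q', hpq, hp, hq'⟩ := Int.exists_gcd_one hg
  set g := Int.gcd p q
  have hg' : (1 : ℝ) ≤ g := by exact_mod_cast hg
  have hq'0 : 0 < q' := by
    by_contra! hcon
    have : (q : ℤ) ≤ 0 := hq' ▸ mul_nonpos_of_nonpos_of_nonneg hcon (by positivity)
    omega
  lift q' to ℕ using hq'0.le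
  have hqr : (q : ℝ) = q' * g := by exact_mod_cast hq'
  have hpr : (p : ℝ) = p' * g := by exact_mod_cast hp
  have hq'1 : (0 : ℝ) < q' := by exact_mod_cast hq'0
  have h1 := hcop q' p' (by exact_mod_cast hq'0) (Int.isCoprime_iff_gcd_eq_one.2 hpq)
  have h2 : |q * α - p| = g * |q' * α - p'| := by
    rw [hqr, hpr, show (q' : ℝ) * g * α - p' * g = g * (q' * α - p') by ring, abs_mul,
      abs_of_pos (by linarith : (0 : ℝ) < g)]
  have h3 : (q : ℝ) ^ (-(1 + δ)) ≤ (q' : ℝ) ^ (-(1 + δ)) :=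
    Real.rpow_le_rpow_of_nonpos hq'1 (by rw [hqr]; nlinarith) (by linarith)
  have h4 : 0 < min c 1 := lt_min hc one_pos
  rw [h2]
  nlinarith [abs_nonneg ((q' : ℝ) * α - p'), mul_le_mul_of_nonneg_left h3 h4.le]

/-- Roth's theorem. -/
theorem exists_le_abs_mul_sub_of_isAlgebraic {α : ℝ} (hα : IsAlgebraic ℚ α) (hirr : Irrational α)
    {δ : ℝ} (hδ : 0 < δ) (hδ1 : δ ≤ 1) :
    ∃ C : ℝ, 0 < C ∧ ∀ (q : ℕ) (p : ℤ), 0 < q → C * (q : ℝ) ^ (-(1 + δ)) ≤ |q * α - p| := by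
  have hα' : IsAlgebraic ℤ α := (IsFractionRing.isAlgebraic_iff ℤ ℚ ℝ).2 hα
  obtain ⟨D, hD, hDα⟩ := hα'.exists_integral_multiple
  rw [zsmul_eq_mul] at hDα
  obtain ⟨C, hC, h⟩ := exists_le_abs_mul_sub_of_isIntegral hDα (hirr.intCast_mul hD) hδ hδ1
  have hD' : (0 : ℝ) < |(D : ℝ)| := abs_pos.2 (by exact_mod_cast hD)
  refine ⟨C / |(D : ℝ)|, by positivity, fun q p hq => ?_⟩
  rw [div_mul_eq_mul_div, div_le_iff₀ hD', ← abs_mul]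
  refine (h q (p * D) hq).trans_eq ?_
  push_cast
  congr 1; ring

theorem exists_le_norm_exp_sub_one {α : ℝ} (hα : IsAlgebraic ℚ α) (hirr : Irrational α)
    {δ : ℝ} (hδ : 0 < δ) (hδ1 : δ ≤ 1) :
    ∃ C : ℝ, 0 < C ∧ ∀ n : ℤ, n ≠ 0 →
      C * |(n : ℝ)| ^ (-(1 + δ)) ≤ ‖Complex.exp (2 * Real.pi * Complex.I * (n * α : ℝ)) - 1‖ := by
  obtain ⟨C, hC, h⟩ := exists_le_abs_mul_sub_of_isAlgebraic hα hirr hδ hδ1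
  refine ⟨C, hC, fun n hn => ?_⟩
  have h1 : C * |(n : ℝ)| ^ (-(1 + δ)) ≤ |n * α - round (n * α)| := by
    have h2 := h n.natAbs
    rw [Nat.cast_natAbs, Int.cast_abs] at h2
    rcases le_total 0 n with h0 | h0
    · have h3 : |(n : ℝ)| = n := abs_of_nonneg (by exact_mod_cast h0)
      have := h2 (round (n * α)) (Int.natAbs_pos.2 hn)
      rwa [h3] at this ⊢
    · have h3 : |(n : ℝ)| = -n := abs_of_nonpos (by exact_mod_cast h0)
      have := h2 (-round (n * α)) (Int.natAbs_pos.2 hn)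
      rw [h3] at this ⊢
      refine this.trans_eq ?_
      rw [← abs_neg]
      push_cast
      congr 1; ring
  refine h1.trans ?_
  set x := (n : ℝ) * α
  have h4 : Complex.exp (2 * Real.pi * Complex.I * (x : ℝ)) =
      Complex.exp (Complex.I * (2 * Real.pi * (x - round x) : ℝ)) := by
    rw [Complex.exp_eq_exp_iff_exists_int]
    refine ⟨round x, ?_⟩
    push_cast
    ring
  rw [h4, Complex.norm_exp_I_mul_ofReal_sub_one, norm_mul, Real.norm_eq_abs, Real.norm_eq_abs]
  have h5 := abs_sub_round x
  have h6 : 2 * Real.pi * (x - round x) / 2 = Real.pi * (x - round x) := by ring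
  have h7 := Real.mul_abs_le_abs_sin (x := Real.pi * (x - round x)) (by
    rw [abs_mul, abs_of_pos Real.pi_pos]
    nlinarith [Real.pi_pos])
  rw [abs_mul, abs_of_pos Real.pi_pos, ← mul_assoc, div_mul_cancel₀ _ Real.pi_ne_zero] at h7
  rw [h6, abs_two]
  nlinarith [abs_nonneg (x - round x)]

theorem exists_contDiff_sub_eq_of_forall_nonpos {r : ℕ} {f : ℝ → ℝ} (hf : ContDiff ℝ r f)
    (h0 : ∀ x ≤ 0, f x = 0) : ∃ u : ℝ → ℝ, ContDiff ℝ r u ∧ ∀ x, u (x + 1) - u x = f x := by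
  have key : ∀ (N : ℕ) (x : ℝ), x ≤ N →
      ∑ k ∈ Finset.range ⌈x⌉₊, f (x - (k + 1)) = ∑ k ∈ Finset.range N, f (x - (k + 1)) := by
    intro N x hx
    refine Finset.sum_subset (Finset.range_mono (Nat.ceil_le.2 hx)) fun k _ hk => h0 _ ?_
    rw [Finset.mem_range, not_lt, Nat.ceil_le] at hk
    linarith
  refine ⟨fun x => ∑ k ∈ Finset.range ⌈x⌉₊, f (x - (k + 1)), ?_, fun x => ?_⟩
  · rw [contDiff_iff_contDiffAt]
    intro x
    obtain ⟨N, hN⟩ := exists_nat_gt x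
    have h : ContDiff ℝ r fun x => ∑ k ∈ Finset.range N, f (x - (k + 1)) :=
      ContDiff.sum fun k _ => hf.comp (contDiff_id.sub contDiff_const)
    refine h.contDiffAt.congr_of_eventuallyEq ?_
    filter_upwards [Iio_mem_nhds hN] with y hy using key N y (le_of_lt hy)
  · obtain ⟨N, hN⟩ := exists_nat_gt x
    dsimp only
    rw [key (N + 1) (x + 1) (by push_cast; linarith), key N x hN.le, Finset.sum_range_succ',
      add_sub_right_comm, ← Finset.sum_sub_distrib, Finset.sum_eq_zero, zero_add]
    · congr 1; push_cast; ring
    · intro k _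
      rw [sub_eq_zero]
      congr 1; push_cast; ring

theorem exists_contDiff_sub_eq {r : ℕ} {f : ℝ → ℝ} (hf : ContDiff ℝ r f) :
    ∃ u : ℝ → ℝ, ContDiff ℝ r u ∧ ∀ x, u (x + 1) - u x = f x := by
  have hs : ContDiff ℝ r Real.smoothTransition := by
    exact_mod_cast Real.smoothTransition.contDiff (n := (r : ℕ∞))
  obtain ⟨u, hu, huf⟩ := exists_contDiff_sub_eq_of_forall_nonpos (hs.mul hf)
    fun x hx => by simp [Real.smoothTransition.zero_of_nonpos hx]
  have hrefl : ∀ a : ℝ, ContDiff ℝ r fun x : ℝ => a - x := fun a => contDiff_const.sub contDiff_id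
  obtain ⟨v, hv, hvf⟩ := exists_contDiff_sub_eq_of_forall_nonpos
    (((contDiff_const (c := (1 : ℝ))).sub hs |>.mul hf).comp (hrefl 1))
    fun x hx => by simp [Real.smoothTransition.one_of_one_le (show 1 ≤ 1 - x by linarith)]
  refine ⟨fun x => u x - v (2 - x), hu.sub (hv.comp (hrefl 2)), fun x => ?_⟩
  have h1 := huf x
  have h2 := hvf (1 - x)
  simp only [Function.comp_apply, sub_sub_cancel] at h2
  rw [show (1 : ℝ) - x + 1 = 2 - x by ring] at h2
  dsimp only
  rw [show (2 : ℝ) - (x + 1) = 1 - x by ring]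
  linarith

theorem summable_sq_abs_pow_mul_norm_fourierCoeffOn (r : ℕ) {f : ℝ → ℂ} (hf : ContDiff ℝ r f)
    (hper : ∀ x, f (x + 1) = f x) :
    Summable fun n : ℤ => (|(n : ℝ)| ^ r * ‖fourierCoeffOn zero_lt_one f n‖) ^ 2 := by
  induction r generalizing f with
  | zero =>
    simp only [pow_zero, one_mul]
    refine (hasSum_sq_fourierCoeffOn zero_lt_one ?_).summable
    obtain ⟨C, hC⟩ := isCompact_Icc.exists_bound_of_continuousOn
      (hf.continuous.continuousOn (s := Set.Icc 0 1))
    refine MeasureTheory.MemLp.of_bound hf.continuous.aestronglyMeasurable C ?_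
    filter_upwards [MeasureTheory.ae_restrict_mem measurableSet_Ioc] with x hx
    exact hC x (Set.Ioc_subset_Icc_self hx)
  | succ r ih =>
    have hf' : ContDiff ℝ r (deriv f) := by
      rw [Nat.cast_succ] at hf
      exact (contDiff_succ_iff_deriv.1 hf).2.2
    have hd : Differentiable ℝ f := hf.differentiable (by simp)
    have hper' : ∀ x, deriv f (x + 1) = deriv f x := fun x => by
      rw [← deriv_comp_add_const]
      congr 1
      exact funext hper
    refine (ih hf' hper').of_nonneg_of_le (fun n => sq_nonneg _) fun n => ?_
    rcases eq_or_ne n 0 with rfl | hn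
    · simp; positivity
    have h := fourierCoeffOn_of_hasDerivAt zero_lt_one hn (fun x _ => (hd x).hasDerivAt)
      (hf'.continuous.intervalIntegrable 0 1)
    have h01 : f 1 - f 0 = 0 := by simpa using sub_eq_zero.2 (hper 0)
    have hn' : 0 < |(n : ℝ)| := abs_pos.2 (by exact_mod_cast hn)
    rw [h, h01]
    refine pow_le_pow_left₀ (by positivity) ?_ 2
    rw [pow_succ, mul_assoc]
    refine mul_le_mul_of_nonneg_left ?_ (by positivity)
    simp only [norm_mul, norm_div, mul_zero, zero_sub, norm_neg]
    simp only [norm_one, Complex.norm_ofNat, Complex.norm_real, Complex.norm_I,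
      Complex.norm_intCast, Real.norm_eq_abs, mul_one, Complex.ofReal_one,
      Complex.ofReal_zero, sub_zero, one_mul, abs_of_pos Real.pi_pos]
    rw [← mul_assoc, mul_one_div, div_eq_mul_inv, mul_inv, mul_comm (2 * Real.pi)⁻¹, ← mul_assoc,
      mul_inv_cancel₀ hn'.ne', one_mul]
    refine mul_le_of_le_one_left (norm_nonneg _) (inv_le_one_of_one_le₀ ?_)
    linarith [Real.pi_gt_three]

theorem iteratedDeriv_const_mul_cexp (a c : ℂ) (k : ℕ) :
    iteratedDeriv k (fun x : ℝ => a * Complex.exp (c * x)) =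
      fun x : ℝ => a * c ^ k * Complex.exp (c * x) := by
  induction k with
  | zero => simp
  | succ k ih =>
    rw [iteratedDeriv_succ, ih]
    ext x
    have h : HasDerivAt (fun x : ℝ => Complex.exp (c * x)) (Complex.exp (c * x) * (c * 1)) x :=
      ((Complex.ofRealCLM.hasDerivAt (x := x)).const_mul c).cexp
    rw [(h.const_mul (a * c ^ k)).deriv]
    ring

theorem hasSum_fourierCoeffOn_mul_cexp {f : ℝ → ℂ} (hf : Continuous f)
    (hper : ∀ x, f (x + 1) = f x) (hs : Summable (fourierCoeffOn zero_lt_one f)) (x : ℝ) :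
    HasSum (fun n : ℤ => fourierCoeffOn zero_lt_one f n *
      Complex.exp (2 * Real.pi * Complex.I * n * x)) (f x) := by
  have hp : Function.Periodic f 1 := hper
  let F : C(AddCircle (1 : ℝ), ℂ) := ⟨hp.lift, continuous_quot_lift _ hf⟩
  have hF : fourierCoeff F = fourierCoeffOn zero_lt_one f := by
    ext n
    rw [fourierCoeff_eq_intervalIntegral _ n 0, fourierCoeffOn_eq_integral]
    simp only [fourier_coe_apply, zero_add, sub_zero]
    rfl
  have h := has_pointwise_sum_fourier_series_of_summable (hF ▸ hs) (x : AddCircle (1 : ℝ))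
  rw [hF] at h
  simp only [fourier_coe_apply, Complex.ofReal_one, div_one, smul_eq_mul] at h
  exact h

theorem exists_contDiff_sub_eq_sub_const {α : ℝ} (hα : IsAlgebraic ℚ α) (hirr : Irrational α)
    {r : ℕ} (hr : 2 ≤ r) {ψ : ℝ → ℝ} (hψ : ContDiff ℝ r ψ) (hper : ∀ x, ψ (x + 1) = ψ x) :
    ∃ (w : ℝ → ℝ) (c : ℝ), ContDiff ℝ (r - 2 : ℕ) w ∧ (∀ x, w (x + 1) = w x) ∧
      ∀ x, w (x + α) - w x = ψ x - c := by
  obtain ⟨C, hC, hdio⟩ := exists_le_norm_exp_sub_one hα hirr (δ := 1 / 4) (by norm_num)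
    (by norm_num)
  set f : ℝ → ℂ := fun x => ψ x with hf
  have hfr : ContDiff ℝ r f := Complex.ofRealCLM.contDiff.comp hψ
  have hfper : ∀ x, f (x + 1) = f x := fun x => by simp [hf, hper]
  have hsq := summable_sq_abs_pow_mul_norm_fourierCoeffOn r hfr hfper
  set b : ℤ → ℂ := fourierCoeffOn zero_lt_one f
  set e : ℤ → ℝ → ℂ := fun n x => Complex.exp (2 * Real.pi * Complex.I * n * x) with he
  have he1 : ∀ n x, ‖e n x‖ = 1 := fun n x => by
    simp only [he]
    rw [show 2 * Real.pi * Complex.I * n * x = ((2 * Real.pi * n * x : ℝ) : ℂ) * Complex.I by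
      push_cast; ring]
    exact Complex.norm_exp_ofReal_mul_I _
  have headd : ∀ n x y, e n (x + y) = e n x * e n y := fun n x y => by
    simp only [he, ← Complex.exp_add]
    congr 1; push_cast; ring
  have hdio' : ∀ n : ℤ, n ≠ 0 → C * |(n : ℝ)| ^ (-(5 / 4) : ℝ) ≤ ‖e n α - 1‖ := fun n hn => by
    have h := hdio n hn
    norm_num at h ⊢
    simpa only [he, mul_assoc] using h
  have hn1 : ∀ n : ℤ, n ≠ 0 → (1 : ℝ) ≤ |(n : ℝ)| := fun n hn => by
    exact_mod_cast Int.one_le_abs hn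
  have hne : ∀ n : ℤ, n ≠ 0 → e n α - 1 ≠ 0 := fun n hn h0 => by
    have h := hdio' n hn
    rw [h0, norm_zero] at h
    have := hn1 n hn
    exact absurd h (not_le.2 (by positivity))
  have he0 : ∀ x, e 0 x = 1 := fun x => by simp [he]
  set a : ℤ → ℂ := fun n => b n / (e n α - 1) with ha
  have ha0 : a 0 = 0 := by simp [ha, he0]
  have hmain : Summable fun n : ℤ => |(n : ℝ)| ^ (r - 2) * ‖a n‖ := by
    have hS : Summable fun n : ℤ => C⁻¹ * ((|(n : ℝ)| ^ r * ‖b n‖) ^ 2 +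
        |(n : ℝ)| ^ (-(3 / 2) : ℝ)) :=
      (hsq.add (Real.summable_abs_int_rpow (by norm_num))).mul_left _
    refine hS.of_nonneg_of_le (fun n => by positivity) fun n => ?_
    rcases eq_or_ne n 0 with rfl | hn
    · rw [ha0, norm_zero, mul_zero]; positivity
    have hn0 : 0 < |(n : ℝ)| := zero_lt_one.trans_le (hn1 n hn)
    have h1 : ‖a n‖ ≤ C⁻¹ * (‖b n‖ * |(n : ℝ)| ^ (5 / 4 : ℝ)) := by
      rw [ha, norm_div, div_le_iff₀ (norm_pos_iff.2 (hne n hn))]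
      calc ‖b n‖ = C⁻¹ * (‖b n‖ * |(n : ℝ)| ^ (5 / 4 : ℝ)) * (C * |(n : ℝ)| ^ (-(5 / 4) : ℝ)) := by
            rw [Real.rpow_neg hn0.le]
            field_simp
        _ ≤ _ := by gcongr; exact hdio' n hn
    have h2 : |(n : ℝ)| ^ (r - 2) * |(n : ℝ)| ^ (5 / 4 : ℝ) =
        |(n : ℝ)| ^ r * |(n : ℝ)| ^ (-(3 / 4) : ℝ) := by
      rw [← Real.rpow_natCast, ← Real.rpow_natCast, ← Real.rpow_add hn0, ← Real.rpow_add hn0,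
        Nat.cast_sub hr]
      congr 1; push_cast; ring
    have h3 : |(n : ℝ)| ^ (-(3 / 2) : ℝ) = (|(n : ℝ)| ^ (-(3 / 4) : ℝ)) ^ 2 := by
      rw [← Real.rpow_natCast, ← Real.rpow_mul hn0.le]
      norm_num
    calc |(n : ℝ)| ^ (r - 2) * ‖a n‖
        ≤ |(n : ℝ)| ^ (r - 2) * (C⁻¹ * (‖b n‖ * |(n : ℝ)| ^ (5 / 4 : ℝ))) := by gcongr
      _ = C⁻¹ * ((|(n : ℝ)| ^ r * ‖b n‖) * |(n : ℝ)| ^ (-(3 / 4) : ℝ)) := by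
          linear_combination C⁻¹ * ‖b n‖ * h2
      _ ≤ _ := by
          rw [h3]
          gcongr
          nlinarith [sq_nonneg (|(n : ℝ)| ^ r * ‖b n‖ - |(n : ℝ)| ^ (-(3 / 4) : ℝ)),
            sq_nonneg (|(n : ℝ)| ^ r * ‖b n‖), sq_nonneg (|(n : ℝ)| ^ (-(3 / 4) : ℝ))]
  have hmain' : ∀ k ≤ r - 2, Summable fun n : ℤ => |(n : ℝ)| ^ k * ‖a n‖ := by
    intro k hk
    refine hmain.of_nonneg_of_le (fun n => by positivity) fun n => ?_
    rcases eq_or_ne n 0 with rfl | hn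
    · simp [ha0]
    · gcongr
      exact hn1 n hn
  have hsum : ∀ x, Summable fun n => a n * e n x := fun x => by
    refine Summable.of_norm ?_
    simpa [he1] using hmain' 0 (Nat.zero_le _)
  have hb : Summable b := by
    refine .of_norm_bounded (((hmain' 0 (Nat.zero_le _)).mul_left 2).add
      (hasSum_ite_eq (0 : ℤ) ‖b 0‖).summable) fun n => ?_
    rcases eq_or_ne n 0 with rfl | hn
    · simp [ha0]
    have h1 : b n = a n * (e n α - 1) := (div_mul_cancel₀ _ (hne n hn)).symm
    have h2 : ‖e n α - 1‖ ≤ 2 := (norm_sub_le _ _).trans (by rw [he1, norm_one]; norm_num)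
    rw [h1, norm_mul, if_neg hn, pow_zero, one_mul, add_zero, mul_comm]
    gcongr
  set W : ℝ → ℂ := fun x => ∑' n, a n * e n x with hW
  have hWsmooth : ContDiff ℝ (r - 2 : ℕ) W := by
    have hN : ((r - 2 : ℕ) : WithTop ℕ∞) = ((r - 2 : ℕ) : ℕ∞) := rfl
    rw [hN]
    refine contDiff_tsum (v := fun k (n : ℤ) => (2 * Real.pi) ^ k * (|(n : ℝ)| ^ k * ‖a n‖))
      ?_ ?_ ?_
    · intro n
      refine contDiff_const.mul (Complex.contDiff_exp.comp ?_)
      exact contDiff_const.mul Complex.ofRealCLM.contDiff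
    · intro k hk
      exact (hmain' k (by exact_mod_cast hk)).mul_left _
    · intro k n x _
      rw [norm_iteratedFDeriv_eq_norm_iteratedDeriv]
      simp only [he]
      rw [iteratedDeriv_const_mul_cexp, norm_mul, norm_mul, norm_pow]
      change _ * _ * ‖e n x‖ ≤ _
      rw [he1]
      simp only [norm_mul, Complex.norm_ofNat, Complex.norm_real, Complex.norm_I,
        Complex.norm_intCast, Real.norm_eq_abs, mul_one, abs_of_pos Real.pi_pos, mul_pow]
      apply le_of_eq; ring
  refine ⟨fun x => (W x).re, (b 0).re, Complex.reCLM.contDiff.comp hWsmooth, fun x => ?_,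
    fun x => ?_⟩
  · have : ∀ n, e n 1 = 1 := fun n => by
      simp only [he]
      rw [← Complex.exp_int_mul_two_pi_mul_I n]
      congr 1; push_cast; ring
    simp only [hW, headd, this, mul_one]
  · have h1 := (hsum (x + α)).hasSum.sub (hsum x).hasSum
    have h2 := (hasSum_fourierCoeffOn_mul_cexp hfr.continuous hfper hb x).sub
      (hasSum_ite_eq (0 : ℤ) (b 0))
    have h3 : W (x + α) - W x = f x - b 0 := by
      refine h1.unique ?_
      convert h2 using 1
      ext n
      change _ = b n * e n x - _
      rcases eq_or_ne n 0 with rfl | hn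
      · simp [ha0, he0]
      · rw [headd, if_neg hn, sub_zero, ha]
        have := hne n hn
        field_simp
    simpa [hf] using congrArg Complex.re h3

theorem add_eq_of_forall_eq_const {G : Type*} [AddCommGroup G] {L : G → ℝ} {Φ : G → ℝ → ℝ}
    (hΦ : ∀ m n x, Φ (n + m) x = Φ m x + Φ n (x + L m)) {e : G} {c : ℝ} (he : ∀ x, Φ e x = c)
    (n : G) (x : ℝ) : Φ n (x + L e) = Φ n x := by
  have h1 := hΦ e n x
  have h2 := hΦ n e x
  rw [add_comm e n, h1, he, he] at h2
  linarith

theorem sub_coboundary_cocycle {G : Type*} [AddCommGroup G] {L : G →+ ℝ} {Φ : G → ℝ → ℝ}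
    (hΦ : ∀ m n x, Φ (n + m) x = Φ m x + Φ n (x + L m)) (u : ℝ → ℝ) (m n : G) (x : ℝ) :
    Φ (n + m) x - (u (x + L (n + m)) - u x) =
      Φ m x - (u (x + L m) - u x) + (Φ n (x + L m) - (u (x + L m + L n) - u (x + L m))) := by
  rw [hΦ, map_add, add_comm (L n), ← add_assoc]
  ring

theorem eq_of_periodic_of_irrational {f : ℝ → ℝ} (hf : Continuous f) {a b : ℝ}
    (ha : ∀ x, f (x + a) = f x) (hb : ∀ x, f (x + b) = f x) (h : Irrational (a / b)) (x : ℝ) :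
    f x = f 0 := by
  have hd := dense_addSubgroupClosure_pair_iff.2 h
  refine congrFun (Continuous.ext_on hd hf continuous_const fun y hy => ?_) x
  have key : ∀ z, f (z + y) = f z := by
    induction hy using AddSubgroup.closure_induction with
    | mem y hy =>
      rcases hy with rfl | rfl
      · exact ha
      · exact hb
    | zero => simp
    | add y z _ _ h1 h2 => exact fun t => by rw [← add_assoc, h2, h1]
    | neg y _ h1 => exact fun t => by rw [← h1, neg_add_cancel_right]
  simpa using key 0

/-- a `C^r` cocycle over the minimal translation `ℤ³`-action
`T(n,x) = x + n·α` (with `α₁ = 1` and `α₂, α₃` irrational algebraic) is a coboundary up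
to a group homomorphism `c : ℤ³ → ℝ`, with a `C^{r-2}` transfer function. -/
theorem stmt5 (α : Fin 3 → ℝ) (hα1 : α 0 = 1)
    (hirr2 : Irrational (α 1)) (halg2 : IsAlgebraic ℚ (α 1))
    (hirr3 : Irrational (α 2)) (halg3 : IsAlgebraic ℚ (α 2))
    (r : ℕ) (hr : 2 ≤ r)
    (Ψ : (Fin 3 → ℤ) → ℝ → ℝ)
    (hcoc : ∀ m n : Fin 3 → ℤ, ∀ x : ℝ,
      Ψ (n + m) x = Ψ m x + Ψ n (x + ∑ i, (m i : ℝ) * α i))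
    (hreg : ∀ n : Fin 3 → ℤ, ContDiff ℝ r (Ψ n)) :
    ∃ (w : ℝ → ℝ) (c : (Fin 3 → ℤ) →+ ℝ),
      Continuous w ∧ ContDiff ℝ (r - 2 : ℕ) w ∧
      ∀ (n : Fin 3 → ℤ) (x : ℝ), Ψ n x = w (x + ∑ i, (n i : ℝ) * α i) - w x + c n := by
  let L : (Fin 3 → ℤ) →+ ℝ :=
    { toFun := fun n => ∑ i, (n i : ℝ) * α i
      map_zero' := by simp
      map_add' := fun m n => by simp [add_mul, Finset.sum_add_distrib] }
  have hL1 : L (Pi.single 0 1) = 1 := by simp [L, Fin.sum_univ_three, hα1]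
  have hL2 : L (Pi.single 1 1) = α 1 := by simp [L, Fin.sum_univ_three]
  obtain ⟨u, hu, hue⟩ := exists_contDiff_sub_eq (hreg (Pi.single 0 1))
  let Φ : (Fin 3 → ℤ) → ℝ → ℝ := fun n x => Ψ n x - (u (x + L n) - u x)
  have hΦ : ∀ m n x, Φ (n + m) x = Φ m x + Φ n (x + L m) :=
    sub_coboundary_cocycle (L := L) hcoc u
  have hΦ1 : ∀ x, Φ (Pi.single 0 1) x = 0 := fun x => by
    simp only [Φ]
    rw [hL1, hue, sub_self]
  have hΦper : ∀ n x, Φ n (x + 1) = Φ n x := by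
    simpa only [hL1] using add_eq_of_forall_eq_const hΦ hΦ1
  have hshift : ∀ n, ContDiff ℝ r fun x : ℝ => x + L n := fun n => contDiff_id.add contDiff_const
  have hΦr : ∀ n, ContDiff ℝ r (Φ n) := fun n => (hreg n).sub ((hu.comp (hshift n)).sub hu)
  obtain ⟨v, c, hv, hvper, hve⟩ := exists_contDiff_sub_eq_sub_const halg2 hirr2 hr
    (hΦr (Pi.single 1 1)) (hΦper _)
  let Θ : (Fin 3 → ℤ) → ℝ → ℝ := fun n x => Φ n x - (v (x + L n) - v x)
  have hΘ : ∀ m n x, Θ (n + m) x = Θ m x + Θ n (x + L m) :=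
    sub_coboundary_cocycle (L := L) hΦ v
  have hΘ1 : ∀ x, Θ (Pi.single 0 1) x = 0 := fun x => by
    simp only [Θ]
    rw [hΦ1, hL1, hvper, sub_self, sub_zero]
  have hΘ2 : ∀ x, Θ (Pi.single 1 1) x = c := fun x => by
    simp only [Θ]
    rw [hL2, hve, sub_sub_cancel]
  have hΘc : ∀ n, Continuous (Θ n) := fun n =>
    (hΦr n).continuous.sub ((hv.continuous.comp (hshift n).continuous).sub hv.continuous)
  have hconst : ∀ n x, Θ n x = Θ n 0 := fun n => by
    refine eq_of_periodic_of_irrational (hΘc n) (a := α 1) (b := 1) (fun x => ?_) (fun x => ?_)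
      (by simpa using hirr2)
    · rw [← hL2, add_eq_of_forall_eq_const hΘ hΘ2]
    · rw [← hL1, add_eq_of_forall_eq_const hΘ hΘ1]
  refine ⟨fun x => u x + v x, AddMonoidHom.mk' (fun n => Θ n 0) fun m n => ?_,
    hu.continuous.add hv.continuous, (hu.of_le (by exact_mod_cast Nat.sub_le r 2)).add hv,
    fun n x => ?_⟩
  · rw [hΘ, hconst m (0 + L n), add_comm]
  · rw [AddMonoidHom.mk'_apply, ← hconst n x]
    change Ψ n x = u (x + L n) + v (x + L n) - (u x + v x) +
      (Ψ n x - (u (x + L n) - u x) - (v (x + L n) - v x))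
    ring
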